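/- There exists a constant c₀ > 0 such that the following holds. Let 0 < c ≤ 1, let d ≥ 66/c, and let n be sufficiently large relative to d. Suppose G is a bipartite graph with n vertices and bipartition V(G) = A ∪ B, where every vertex in A has degree at least d and |A| = c·n. Suppose we are given integers a_k for k ∈ ℤ and integers b_v for v ∈ V(G). Let H be the random subgraph of G obtained by independently keeping, for each vertex v ∈ A, one uniformly random edge incident to v (and deleting all other edges), and let n_H(k) denote the number of vertices v ∈ V(H) with d_H(v) + b_v = k. Then ℙ(n_H(k) = a_k for every k ∈ ℤ) ≤ n^{-c₀·c·d}. -/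

import Mathlib

namespace DegreeSequence

open Finset

variable {V : Type*} [Fintype V] [DecidableEq V]

/-- Restricting one coordinate of a product to the complement of a point, summed over all
points, counts every element of the product once for each other point. -/
lemma sum_card_piFinset_erase (P : (V → V) → Prop) [DecidablePred P] (t : V → Finset V) (v : V) :
    ∑ x ∈ t v, #{σ ∈ Fintype.piFinset (Function.update t v ((t v).erase x)) | P σ} =
      (#(t v) - 1) * #{σ ∈ Fintype.piFinset t | P σ} := by
  have h1 : ∀ x ∈ t v, {σ ∈ Fintype.piFinset (Function.update t v ((t v).erase x)) | P σ} =
      {σ ∈ ({σ ∈ Fintype.piFinset t | P σ} : Finset (V → V)) | σ v ≠ x} := by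
    intro x _
    ext σ
    simp only [mem_filter, Fintype.mem_piFinset]
    constructor
    · rintro ⟨h, hP⟩
      have hv := h v
      simp only [Function.update_self, mem_erase] at hv
      refine ⟨⟨fun a => ?_, hP⟩, hv.1⟩
      by_cases ha : a = v
      · subst ha; exact hv.2
      · simpa [ha] using h a
    · rintro ⟨⟨h, hP⟩, hv⟩
      refine ⟨fun a => ?_, hP⟩
      by_cases ha : a = v
      · subst ha; simp [hv, h a]
      · simpa [ha] using h a
  rw [sum_congr rfl fun x hx => by rw [h1 x hx]]
  simp only [card_filter _ ({σ ∈ Fintype.piFinset t | P σ} : Finset (V → V))]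
  rw [sum_comm, mul_comm, ← smul_eq_mul, ← sum_const]
  refine sum_congr rfl fun σ hσ => ?_
  rw [← card_filter, filter_ne, card_erase_of_mem]
  exact Fintype.mem_piFinset.1 (mem_filter.1 hσ).1 v

/-- To bound the density of a property on a product set, it suffices to bound it on all
sub-products whose factors have prescribed (smaller) sizes. -/
lemma card_filter_piFinset_le_of_forall_subset (P : (V → V) → Prop) [DecidablePred P] (κ : V → ℕ)
    (hκ : ∀ v, 1 ≤ κ v) (q : ℝ) (t : V → Finset V) (ht : ∀ v, κ v ≤ #(t v))
    (h : ∀ t' : V → Finset V, (∀ v, t' v ⊆ t v) → (∀ v, #(t' v) = κ v) →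
      (#{σ ∈ Fintype.piFinset t' | P σ} : ℝ) ≤ q * #(Fintype.piFinset t')) :
    (#{σ ∈ Fintype.piFinset t | P σ} : ℝ) ≤ q * #(Fintype.piFinset t) := by
  induction hn : ∑ v, #(t v) using Nat.strong_induction_on generalizing t with
  | _ n ih =>
    by_cases hall : ∀ v, #(t v) = κ v
    · exact h t (fun v => Subset.rfl) hall
    push Not at hall
    obtain ⟨v, hv⟩ := hall
    have hlt : κ v < #(t v) := lt_of_le_of_ne (ht v) (Ne.symm hv)
    have key : ∀ x ∈ t v,
        (#{σ ∈ Fintype.piFinset (Function.update t v ((t v).erase x)) | P σ} : ℝ) ≤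
          q * #(Fintype.piFinset (Function.update t v ((t v).erase x))) := by
      intro x hx
      have hsub : ∀ a, Function.update t v ((t v).erase x) a ⊆ t a := by
        intro a
        by_cases ha : a = v
        · subst ha; simpa using erase_subset x (t a)
        · simp [ha]
      refine ih _ ?_ _ ?_ (fun t' h1 h2 => h t' (fun a => (h1 a).trans (hsub a)) h2) rfl
      · rw [← hn]
        refine sum_lt_sum (fun a _ => card_le_card (hsub a)) ⟨v, mem_univ _, ?_⟩
        simpa using card_erase_lt_of_mem hx
      · intro a
        by_cases ha : a = v
        · subst ha
          simp only [Function.update_self, card_erase_of_mem hx]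
          omega
        · simpa [ha] using ht a
    have hs := sum_le_sum key
    rw [← mul_sum] at hs
    have e1 := sum_card_piFinset_erase P t v
    have e2 := sum_card_piFinset_erase (fun _ => True) t v
    simp only [filter_true] at e2
    have e1' := congrArg (Nat.cast : ℕ → ℝ) e1
    have e2' := congrArg (Nat.cast : ℕ → ℝ) e2
    have hv1 : 1 ≤ #(t v) := by have := hκ v; omega
    push_cast [Nat.cast_sub hv1] at e1' e2'
    rw [e1', e2'] at hs
    have hpos : (0 : ℝ) < (#(t v) : ℝ) - 1 := by
      have : 1 < #(t v) := by have := hκ v; omega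
      have : (1 : ℝ) < #(t v) := by exact_mod_cast this
      linarith
    refine le_of_mul_le_mul_left ?_ hpos
    linarith

/-- Central binomial coefficients are at most `2 ^ N / √(N + 1)`. -/
lemma choose_half_sq_mul_le (N : ℕ) : (N.choose (N / 2)) ^ 2 * (N + 1) ≤ 4 ^ N := by
  have hc : ∀ k : ℕ, k.centralBinom ^ 2 * (2 * k + 1) ≤ 16 ^ k := by
    intro k
    induction k with
    | zero => simp
    | succ k ih =>
      have h := Nat.succ_mul_centralBinom_succ k
      have h2 : (k + 1) ^ 2 * ((k + 1).centralBinom ^ 2 * (2 * (k + 1) + 1)) ≤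
          (k + 1) ^ 2 * 16 ^ (k + 1) := by
        calc (k + 1) ^ 2 * ((k + 1).centralBinom ^ 2 * (2 * (k + 1) + 1))
            = ((k + 1) * (k + 1).centralBinom) ^ 2 * (2 * k + 3) := by ring
          _ = 4 * ((2 * k + 1) * (2 * k + 3)) * (k.centralBinom ^ 2 * (2 * k + 1)) := by
              rw [h]; ring
          _ ≤ 4 * (4 * (k + 1) ^ 2) * 16 ^ k := by
              refine Nat.mul_le_mul (Nat.mul_le_mul_left 4 ?_) ih
              nlinarith
          _ = (k + 1) ^ 2 * 16 ^ (k + 1) := by ring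
      exact Nat.le_of_mul_le_mul_left h2 (by positivity)
  obtain ⟨k, rfl | rfl⟩ := N.even_or_odd'
  · have := hc k
    rw [Nat.centralBinom] at this
    rw [Nat.mul_div_cancel_left k two_pos, pow_mul]
    exact this
  · have h1 : (2 * k + 1) / 2 = k := by omega
    rw [h1]
    have h2 : (k + 1).centralBinom = 2 * (2 * k + 1).choose k := by
      rw [Nat.centralBinom, show 2 * (k + 1) = (2 * k + 1) + 1 by ring, Nat.choose_succ_succ',
        Nat.choose_symm_half]
      ring
    have h3 := hc (k + 1)
    rw [h2] at h3
    have h4 : 4 ^ (2 * k + 1) = 4 * 16 ^ k := by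
      rw [pow_succ, pow_mul]; norm_num [mul_comm]
    rw [h4]
    have h5 : 16 ^ (k + 1) = 16 * 16 ^ k := by ring
    rw [h5] at h3
    nlinarith

lemma choose_half_le (N R : ℕ) (hR : R ^ 2 ≤ N) :
    (R : ℝ) * N.choose (N / 2) ≤ 2 ^ N := by
  have h := choose_half_sq_mul_le N
  have : (R * N.choose (N / 2)) ^ 2 ≤ (2 ^ N) ^ 2 := by
    calc (R * N.choose (N / 2)) ^ 2 = (N.choose (N / 2)) ^ 2 * R ^ 2 := by ring
      _ ≤ (N.choose (N / 2)) ^ 2 * (N + 1) := by gcongr; omega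
      _ ≤ 4 ^ N := h
      _ = (2 ^ N) ^ 2 := by rw [← pow_mul, mul_comm, pow_mul]; norm_num
  have := (Nat.pow_le_pow_iff_left two_ne_zero).1 this
  exact_mod_cast this

/-- If the number of elements of `F` in each level set of `p`, given the part of `F` below that
level, takes at most `K` values as `F` ranges over a family of subsets of `S`, then the family
is small. -/
lemma card_family_le {ι : Type*} [DecidableEq ι] (p : ι → ℤ) (K : ℕ) (S : Finset ι)
    (𝓕 : Finset (Finset ι)) (h𝓕 : ∀ F ∈ 𝓕, F ⊆ S)
    (h : ∀ (z : ℤ) (G : Finset ι),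
      #(image (fun F => #{x ∈ F | p x = z}) (𝓕.filter fun F => F.filter (p · < z) = G)) ≤ K) :
    #𝓕 ≤ ∏ z ∈ S.image p, K * (#{x ∈ S | p x = z}).choose (#{x ∈ S | p x = z} / 2) := by
  induction hn : #S using Nat.strong_induction_on generalizing S 𝓕 with
  | _ n ih =>
    rcases S.eq_empty_or_nonempty with rfl | hS
    · have : 𝓕 ⊆ {∅} := fun F hF => by simpa using h𝓕 F hF
      simpa using card_le_card this
    set z := (S.image p).max' (hS.image p) with hz
    have hzmem : z ∈ S.image p := max'_mem _ _
    have hle : ∀ x ∈ S, p x ≤ z := fun x hx => le_max' _ _ (mem_image_of_mem p hx)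
    set S' : Finset ι := {x ∈ S | p x < z} with hS'
    set 𝓕' : Finset (Finset ι) := 𝓕.image (fun F => F.filter (p · < z)) with h𝓕'
    have hcard : #S' < n := by
      rw [← hn]
      obtain ⟨x, hx, hxz⟩ := mem_image.1 hzmem
      exact card_lt_card (filter_ssubset.2 ⟨x, hx, by simp [hxz]⟩)
    have himg : S'.image p = (S.image p).erase z := by
      ext y
      simp only [hS', mem_image, mem_filter, mem_erase]
      constructor
      · rintro ⟨x, ⟨hx, hlt⟩, rfl⟩
        exact ⟨hlt.ne, x, hx, rfl⟩
      · rintro ⟨hne, x, hx, rfl⟩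
        exact ⟨x, ⟨hx, lt_of_le_of_ne (hle x hx) hne⟩, rfl⟩
    have ih' := ih _ hcard S' 𝓕' (by
      intro F hF
      obtain ⟨F₀, hF₀, rfl⟩ := mem_image.1 hF
      exact filter_subset_filter _ (h𝓕 F₀ hF₀)) (by
      intro y G
      rcases le_or_gt z y with hzy | hzy
      · have h0 : ∀ F ∈ 𝓕'.filter (fun F => F.filter (p · < y) = G),
            #{x ∈ F | p x = y} = 0 := by
          intro F hF
          obtain ⟨F₀, hF₀, rfl⟩ := mem_image.1 (mem_filter.1 hF).1
          rw [card_eq_zero, filter_eq_empty_iff]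
          intro x hx
          have := (mem_filter.1 hx).2
          omega
        have hK : ∀ F ∈ 𝓕, 1 ≤ K := fun F hF => by
          refine le_trans ?_ (h z {x ∈ F | p x < z})
          exact card_pos.2 ⟨_, mem_image_of_mem _ (mem_filter.2 ⟨hF, rfl⟩)⟩
        rcases (𝓕'.filter (fun F => F.filter (p · < y) = G)).eq_empty_or_nonempty
          with he | ⟨F, hF⟩
        · rw [he]; simp
        · obtain ⟨F₀, hF₀, -⟩ := mem_image.1 (mem_filter.1 hF).1
          refine le_trans (card_le_one.2 ?_) (hK F₀ hF₀)
          intro a ha b hb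
          obtain ⟨Fa, hFa, rfl⟩ := mem_image.1 ha
          obtain ⟨Fb, hFb, rfl⟩ := mem_image.1 hb
          rw [h0 Fa hFa, h0 Fb hFb]
      · refine le_trans (card_le_card ?_) (h y G)
        intro a ha
        obtain ⟨F, hF, rfl⟩ := mem_image.1 ha
        obtain ⟨hF1, hF2⟩ := mem_filter.1 hF
        obtain ⟨F₀, hF₀, rfl⟩ := mem_image.1 hF1
        refine mem_image.2 ⟨F₀, mem_filter.2 ⟨hF₀, ?_⟩, ?_⟩
        · rw [← hF2, filter_filter]
          refine filter_congr fun x _ => ?_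
          constructor <;> intro <;> omega
        · rw [filter_filter]
          congr 1
          refine filter_congr fun x _ => ?_
          constructor <;> intro <;> omega) rfl
    have hfac : ∀ y ∈ S'.image p, #{x ∈ S' | p x = y} = #{x ∈ S | p x = y} := by
      intro y hy
      rw [himg, mem_erase] at hy
      have hyz : y < z := lt_of_le_of_ne (le_max' _ _ hy.2) hy.1
      rw [hS', filter_filter]
      congr 1
      refine filter_congr fun x _ => ?_
      constructor <;> intro <;> omega
    rw [prod_congr rfl fun y hy => by rw [hfac y hy], himg] at ih'
    rw [← mul_prod_erase _ _ hzmem, mul_comm]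
    refine le_trans ?_ (Nat.mul_le_mul_right _ ih')
    rw [mul_comm]
    refine card_le_mul_card_image 𝓕 _ fun G _ => ?_
    set Sz : Finset ι := {x ∈ S | p x = z} with hSz
    set vals := image (fun F => #{x ∈ F | p x = z}) (𝓕.filter fun F => F.filter (p · < z) = G) with hvals
    have hinj : Set.InjOn (fun F : Finset ι => {x ∈ F | p x = z})
        (𝓕.filter (fun F => F.filter (p · < z) = G) : Set (Finset ι)) := by
      intro F hF F' hF' he
      simp only [coe_filter, Set.mem_ofPred_eq] at hF hF'
      have hsplit : ∀ F ∈ 𝓕, F = {x ∈ F | p x = z} ∪ {x ∈ F | p x < z} := by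
        intro F hF
        rw [← filter_or, filter_true_of_mem]
        intro x hx
        have := hle x (h𝓕 F hF hx)
        omega
      rw [hsplit F hF.1, hsplit F' hF'.1, hF.2, hF'.2]
      exact congrArg (· ∪ G) he
    rw [← card_image_of_injOn hinj]
    calc _ ≤ #(vals.biUnion fun k => powersetCard k Sz) := by
          refine card_le_card fun W hW => ?_
          obtain ⟨F, hF, rfl⟩ := mem_image.1 hW
          refine mem_biUnion.2 ⟨_, mem_image_of_mem _ hF, mem_powersetCard.2 ⟨?_, rfl⟩⟩
          exact filter_subset_filter _ (h𝓕 F (mem_filter.1 hF).1)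
      _ ≤ ∑ k ∈ vals, (#Sz).choose k := by
          refine card_biUnion_le.trans (le_of_eq ?_)
          simp
      _ ≤ ∑ _k ∈ vals, (#Sz).choose (#Sz / 2) := sum_le_sum fun k _ => Nat.choose_le_middle _ _
      _ ≤ K * (#Sz).choose (#Sz / 2) := by
          rw [sum_const, smul_eq_mul]
          exact Nat.mul_le_mul_right _ (h z G)

/-- The gadget with key vertex `x` and block `X x` is active at `σ` if `σ` follows the template
`τ` on the block, except that it may use the alternative value `u x` at the key vertex. -/
def Active (X : V → Finset V) (τ u : V → V) (σ : V → V) (x : V) : Prop :=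
  (∀ v ∈ X x, v ≠ x → σ v = τ v) ∧ (σ x = τ x ∨ σ x = u x)

instance (X : V → Finset V) (τ u : V → V) (σ : V → V) : DecidablePred (Active X τ u σ) :=
  fun _ => inferInstanceAs (Decidable (_ ∧ _))

lemma sum_half_pow_active_le (t : V → Finset V) (X : V → Finset V) (τ u : V → V) (Q : ℕ)
    (Γ : Finset V) (hx : ∀ x ∈ Γ, x ∈ X x)
    (hdisj : ∀ x ∈ Γ, ∀ y ∈ Γ, x ≠ y → Disjoint (X x) (X y))
    (hτ : ∀ x ∈ Γ, ∀ v ∈ X x, τ v ∈ t v) (hQ : ∀ x ∈ Γ, ∏ v ∈ X x, #(t v) ≤ Q) :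
    ∑ σ ∈ Fintype.piFinset t, (1 / 2 : ℝ) ^ #{x ∈ Γ | Active X τ u σ x} ≤
      (1 - 1 / (2 * Q)) ^ #Γ * #(Fintype.piFinset t) := by
  induction Γ using Finset.induction_on with
  | empty => simp
  | insert x Γ hxΓ ih =>
    have ih' := ih (fun y hy => hx y (mem_insert_of_mem hy))
      (fun y hy z hz => hdisj y (mem_insert_of_mem hy) z (mem_insert_of_mem hz))
      (fun y hy => hτ y (mem_insert_of_mem hy)) (fun y hy => hQ y (mem_insert_of_mem hy))
    set π : (V → V) → V → V := fun σ v => if v ∈ X x then τ v else σ v with hπ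
    have hτx := hτ x (mem_insert_self _ _)
    have hmaps : ∀ σ ∈ Fintype.piFinset t, π σ ∈ Fintype.piFinset t := by
      intro σ hσ
      rw [Fintype.mem_piFinset] at hσ ⊢
      intro v
      by_cases hv : v ∈ X x
      · simpa [hπ, hv] using hτx v hv
      · simpa [hπ, hv] using hσ v
    have hother : ∀ σ, #{y ∈ Γ | Active X τ u σ y} = #{y ∈ Γ | Active X τ u (π σ) y} := by
      intro σ
      congr 1
      refine filter_congr fun y hy => ?_
      have hyx : y ≠ x := fun h => hxΓ (h ▸ hy)
      have hd := hdisj y (mem_insert_of_mem hy) x (mem_insert_self _ _) hyx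
      have hag : ∀ v ∈ X y, π σ v = σ v := fun v hv => by
        simp [hπ, Finset.disjoint_left.1 hd hv]
      have hy' := hag y (hx y (mem_insert_of_mem hy))
      unfold Active
      rw [hy']
      refine and_congr_left fun _ => forall_congr' fun v => forall_congr' fun hv => ?_
      rw [hag v hv]
    have hins : ∀ σ, (1 / 2 : ℝ) ^ #{y ∈ insert x Γ | Active X τ u σ y} =
        (1 / 2 : ℝ) ^ #{y ∈ Γ | Active X τ u (π σ) y} *
          (1 - if Active X τ u σ x then 1 / 2 else 0) := by
      intro σ
      rw [← hother, filter_insert]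
      split_ifs with h
      · rw [card_insert_of_notMem (by simp [hxΓ]), pow_succ]; norm_num
      · simp
    have hfib : ∀ ρ ∈ Fintype.piFinset t,
        ∑ σ ∈ Fintype.piFinset t with π σ = ρ, (1 / 2 : ℝ) ^ #{y ∈ insert x Γ | Active X τ u σ y} ≤
          (1 - 1 / (2 * Q)) * ∑ σ ∈ Fintype.piFinset t with π σ = ρ,
            (1 / 2 : ℝ) ^ #{y ∈ Γ | Active X τ u σ y} := by
      intro ρ hρ
      rcases ({σ ∈ Fintype.piFinset t | π σ = ρ} : Finset _).eq_empty_or_nonempty with he | ⟨σ₀, hσ₀⟩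
      · rw [he]; simp
      obtain ⟨hσ₀t, hσ₀⟩ := mem_filter.1 hσ₀
      have hρval : ∀ v ∈ X x, ρ v = τ v := fun v hv => by rw [← hσ₀]; simp [hπ, hv]
      have hρρ : π ρ = ρ := by
        funext v
        by_cases hv : v ∈ X x
        · simp [hπ, hv, hρval v hv]
        · simp [hπ, hv]
      set fib : Finset (V → V) := {σ ∈ Fintype.piFinset t | π σ = ρ} with hfibdef
      have hρfib : ρ ∈ fib := mem_filter.2 ⟨hρ, hρρ⟩
      have hact : Active X τ u ρ x :=
        ⟨fun v hv _ => hρval v hv, Or.inl (hρval x (hx x (mem_insert_self _ _)))⟩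
      have hcard : #fib ≤ Q := by
        refine le_trans ?_ (hQ x (mem_insert_self _ _))
        have : #(Fintype.piFinset fun v : X x => t v) = ∏ v ∈ X x, #(t v) := by
          rw [Fintype.card_piFinset, prod_coe_sort (X x) fun v => #(t v)]
        rw [← this]
        refine card_le_card_of_injOn (fun σ v => σ v) ?_ ?_
        · intro σ hσ
          have := Fintype.mem_piFinset.1 (mem_filter.1 hσ).1
          simpa using fun a _ => this a
        · intro σ hσ σ' hσ' he
          funext v
          by_cases hv : v ∈ X x
          · exact congrFun he ⟨v, hv⟩
          · have h1 := congrFun (mem_filter.1 hσ).2 v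
            have h2 := congrFun (mem_filter.1 hσ').2 v
            simp only [hπ, hv, if_false] at h1 h2
            rw [h1, h2]
      have hQpos : (0 : ℝ) < Q := by
        have : 0 < #fib := card_pos.2 ⟨ρ, hρfib⟩
        exact_mod_cast this.trans_le hcard
      set g : ℝ := (1 / 2 : ℝ) ^ #{y ∈ Γ | Active X τ u ρ y} with hg
      have hg0 : 0 ≤ g := by positivity
      have e1 : ∑ σ ∈ fib, (1 / 2 : ℝ) ^ #{y ∈ insert x Γ | Active X τ u σ y} =
          g * ∑ σ ∈ fib, (1 - if Active X τ u σ x then 1 / 2 else 0 : ℝ) := by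
        rw [mul_sum]
        refine sum_congr rfl fun σ hσ => ?_
        rw [hins, (mem_filter.1 hσ).2]
      have e2 : ∑ σ ∈ fib, (1 / 2 : ℝ) ^ #{y ∈ Γ | Active X τ u σ y} = g * #fib := by
        rw [mul_comm, ← nsmul_eq_mul, ← sum_const]
        refine sum_congr rfl fun σ hσ => ?_
        rw [hother, (mem_filter.1 hσ).2]
      rw [e1, e2]
      have e3 : ∑ σ ∈ fib, (1 - if Active X τ u σ x then 1 / 2 else 0 : ℝ) ≤ #fib - 1 / 2 := by
        rw [sum_sub_distrib, sum_const, nsmul_eq_mul, mul_one]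
        refine sub_le_sub_left ?_ _
        refine le_trans ?_ (single_le_sum (f := fun σ => if Active X τ u σ x then (1 / 2 : ℝ) else 0)
          (fun σ _ => ?_) hρfib)
        · simp [hact]
        · split_ifs <;> norm_num
      calc g * _ ≤ g * (#fib - 1 / 2) := mul_le_mul_of_nonneg_left e3 hg0
        _ ≤ g * ((1 - 1 / (2 * Q)) * #fib) := by
          refine mul_le_mul_of_nonneg_left ?_ hg0
          have : (#fib : ℝ) / (2 * Q) ≤ 1 / 2 := by
            rw [div_le_iff₀ (by positivity)]
            have : (#fib : ℝ) ≤ Q := by exact_mod_cast hcard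
            linarith
          have e : (1 - 1 / (2 * (Q : ℝ))) * #fib = #fib - #fib / (2 * Q) := by ring
          linarith
        _ = _ := by ring
    rw [card_insert_of_notMem hxΓ, pow_succ]
    rw [← sum_fiberwise_of_maps_to hmaps]
    refine (sum_le_sum hfib).trans ?_
    rw [← mul_sum, sum_fiberwise_of_maps_to hmaps]
    rcases (Fintype.piFinset t).eq_empty_or_nonempty with he | ⟨σ, hσ⟩
    · simp [he]
    have hQ1 : 1 ≤ Q := by
      refine le_trans ?_ (hQ x (mem_insert_self _ _))
      exact Nat.one_le_iff_ne_zero.2 (prod_ne_zero_iff.2 fun v _ =>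
        (card_pos.2 ⟨_, Fintype.mem_piFinset.1 hσ v⟩).ne')
    have hQ0 : (0 : ℝ) ≤ 1 - 1 / (2 * Q) := by
      have : (1 : ℝ) ≤ Q := by exact_mod_cast hQ1
      have : 1 / (2 * (Q : ℝ)) ≤ 1 := by
        rw [div_le_one (by positivity)]; linarith
      linarith
    calc _ ≤ (1 - 1 / (2 * (Q : ℝ))) * ((1 - 1 / (2 * Q)) ^ #Γ * #(Fintype.piFinset t)) :=
          mul_le_mul_of_nonneg_left ih' hQ0
      _ = _ := by ring

/-- Few active gadgets are exponentially unlikely. -/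
lemma card_few_active_le (t : V → Finset V) (X : V → Finset V) (τ u : V → V) (Q T : ℕ)
    (Γ : Finset V) (hx : ∀ x ∈ Γ, x ∈ X x)
    (hdisj : ∀ x ∈ Γ, ∀ y ∈ Γ, x ≠ y → Disjoint (X x) (X y))
    (hτ : ∀ x ∈ Γ, ∀ v ∈ X x, τ v ∈ t v) (hQ : ∀ x ∈ Γ, ∏ v ∈ X x, #(t v) ≤ Q) (hQ1 : 1 ≤ Q)
    (hT : 4 * Q * T ≤ #Γ) :
    (#{σ ∈ Fintype.piFinset t | #{x ∈ Γ | Active X τ u σ x} < T} : ℝ) ≤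
      Real.exp (-T) * #(Fintype.piFinset t) := by
  have h := sum_half_pow_active_le t X τ u Q Γ hx hdisj hτ hQ
  have h1 : (#{σ ∈ Fintype.piFinset t | #{x ∈ Γ | Active X τ u σ x} < T} : ℝ) * (1 / 2) ^ T ≤
      ∑ σ ∈ Fintype.piFinset t, (1 / 2 : ℝ) ^ #{x ∈ Γ | Active X τ u σ x} := by
    rw [← nsmul_eq_mul, ← sum_const]
    refine le_trans (sum_le_sum fun σ hσ => ?_)
      (sum_le_sum_of_subset_of_nonneg (filter_subset _ _) fun _ _ _ => by positivity)
    exact pow_le_pow_of_le_one (by norm_num) (by norm_num) (mem_filter.1 hσ).2.le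
  have hQr : (1 : ℝ) ≤ Q := by exact_mod_cast hQ1
  have h2 : (1 - 1 / (2 * (Q : ℝ))) ^ #Γ ≤ Real.exp (-(2 * T)) := by
    calc (1 - 1 / (2 * (Q : ℝ))) ^ #Γ ≤ Real.exp (-(1 / (2 * Q))) ^ #Γ := by
          refine pow_le_pow_left₀ ?_ (Real.one_sub_le_exp_neg _) _
          have : 1 / (2 * (Q : ℝ)) ≤ 1 := by
            rw [div_le_one (by positivity)]; linarith
          linarith
      _ = Real.exp (-(#Γ / (2 * Q))) := by
          rw [← Real.exp_nat_mul]; congr 1; ring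
      _ ≤ _ := by
          rw [Real.exp_le_exp, neg_le_neg_iff, le_div_iff₀ (by positivity)]
          have : ((4 * Q * T : ℕ) : ℝ) ≤ #Γ := by exact_mod_cast hT
          push_cast at this
          linarith
  have h3 : (1 : ℝ) ≤ (1 / 2) ^ T * Real.exp T := by
    rw [show (T : ℝ) = T * 1 by ring, Real.exp_nat_mul, ← mul_pow]
    refine one_le_pow₀ ?_
    have := Real.add_one_le_exp (1 : ℝ)
    linarith
  calc (#{σ ∈ Fintype.piFinset t | #{x ∈ Γ | Active X τ u σ x} < T} : ℝ)
      ≤ #{σ ∈ Fintype.piFinset t | #{x ∈ Γ | Active X τ u σ x} < T} *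
          ((1 / 2) ^ T * Real.exp T) := le_mul_of_one_le_right (by positivity) h3
    _ ≤ (Real.exp (-(2 * T)) * #(Fintype.piFinset t)) * Real.exp T := by
        rw [← mul_assoc]
        refine mul_le_mul_of_nonneg_right ?_ (Real.exp_pos _).le
        exact h1.trans (h.trans (mul_le_mul_of_nonneg_right h2 (by positivity)))
    _ = _ := by
        rw [mul_right_comm, ← Real.exp_add]; congr 2; ring

/-- Switch the values of `σ` on `F` to the alternative values `u`. -/
def switch (u σ : V → V) (F : Finset V) (v : V) : V := if v ∈ F then u v else σ v

/-- Density bound for a property of a random element of a product set, given disjoint gadgets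
organised in `h` families: if, after revealing everything except the choice between `τ x` and `u x`
at the key vertices of the active gadgets, the property only leaves few possibilities, then it is
unlikely. -/
lemma card_filter_le_of_gadgets (P : (V → V) → Prop) [DecidablePred P] (t : V → Finset V)
    (X : V → Finset V) (τ u : V → V) (K M Q h : ℕ) (hM : 1 ≤ M) (Γ : Finset V) (fam : V → Fin h)
    (hx : ∀ x ∈ Γ, x ∈ X x)
    (hdisj : ∀ x ∈ Γ, ∀ y ∈ Γ, x ≠ y → Disjoint (X x) (X y))
    (hτ : ∀ x ∈ Γ, ∀ v ∈ X x, τ v ∈ t v) (hu : ∀ x ∈ Γ, u x ∈ t x) (huτ : ∀ x ∈ Γ, u x ≠ τ x)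
    (hQ : ∀ x ∈ Γ, ∏ v ∈ X x, #(t v) ≤ Q) (hQ1 : 1 ≤ Q)
    (hfam : ∀ i, 4 * Q * M ^ 4 ≤ #{x ∈ Γ | fam x = i})
    (hP : ∀ σ ∈ Fintype.piFinset t, ∀ S ⊆ Γ, (∀ x ∈ S, Active X τ u σ x) → (∀ x ∈ S, σ x = τ x) →
      #{F ∈ S.powerset | P (switch u σ F)} ≤
        ∏ i, K * (#{x ∈ S | fam x = i}).choose (#{x ∈ S | fam x = i} / 2)) :
    (#{σ ∈ Fintype.piFinset t | P σ} : ℝ) ≤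
      ((K / M ^ 2 : ℝ) ^ h + h * Real.exp (-(M ^ 4 : ℕ))) * #(Fintype.piFinset t) := by
  set good : (V → V) → Prop := fun σ =>
    ∀ i, M ^ 4 ≤ #{x ∈ ({x ∈ Γ | fam x = i} : Finset V) | Active X τ u σ x} with hgood
  have hbad : (#{σ ∈ Fintype.piFinset t | ¬ good σ} : ℝ) ≤
      h * Real.exp (-(M ^ 4 : ℕ)) * #(Fintype.piFinset t) := by
    have hsub : ({σ ∈ Fintype.piFinset t | ¬ good σ} : Finset (V → V)) ⊆
        univ.biUnion fun i : Fin h => {σ ∈ Fintype.piFinset t |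
          #{x ∈ ({x ∈ Γ | fam x = i} : Finset V) | Active X τ u σ x} < M ^ 4} := by
      intro σ hσ
      obtain ⟨h1, h2⟩ := mem_filter.1 hσ
      simp only [hgood, not_forall, not_le] at h2
      obtain ⟨i, hi⟩ := h2
      exact mem_biUnion.2 ⟨i, mem_univ _, mem_filter.2 ⟨h1, hi⟩⟩
    calc (#{σ ∈ Fintype.piFinset t | ¬ good σ} : ℝ)
        ≤ ∑ i : Fin h, (#{σ ∈ Fintype.piFinset t |
          #{x ∈ ({x ∈ Γ | fam x = i} : Finset V) | Active X τ u σ x} < M ^ 4} : ℝ) := by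
          exact_mod_cast (card_le_card hsub).trans card_biUnion_le
      _ ≤ ∑ _i : Fin h, Real.exp (-(M ^ 4 : ℕ)) * #(Fintype.piFinset t) := by
          refine sum_le_sum fun i _ => ?_
          have hsubΓ : ({x ∈ Γ | fam x = i} : Finset V) ⊆ Γ := filter_subset _ _
          exact card_few_active_le t X τ u Q (M ^ 4) _ (fun x h => hx x (hsubΓ h))
            (fun x h y h' => hdisj x (hsubΓ h) y (hsubΓ h')) (fun x h => hτ x (hsubΓ h))
            (fun x h => hQ x (hsubΓ h)) hQ1 (hfam i)
      _ = _ := by rw [sum_const, card_univ, Fintype.card_fin, nsmul_eq_mul, mul_assoc]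
  set rep : (V → V) → V → V := fun σ v => if v ∈ Γ ∧ Active X τ u σ v then τ v else σ v with hrep
  have hmaps : ∀ σ ∈ Fintype.piFinset t, rep σ ∈ Fintype.piFinset t := by
    intro σ hσ
    rw [Fintype.mem_piFinset] at hσ ⊢
    intro v
    by_cases hv : v ∈ Γ ∧ Active X τ u σ v
    · simpa [hrep, hv] using hτ v hv.1 v (hx v hv.1)
    · simpa [hrep, hv] using hσ v
  have hloc : ∀ σ σ' : V → V, ∀ x ∈ Γ, (∀ v ∈ X x, v ≠ x → σ v = σ' v) →
      (σ' x = τ x ∨ σ' x = u x) → Active X τ u σ x → Active X τ u σ' x := by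
    intro σ σ' x hxΓ h1 h2 h3
    exact ⟨fun v hv hne => (h1 v hv hne).symm.trans (h3.1 v hv hne), h2⟩
  have hnot : ∀ x ∈ Γ, ∀ v ∈ X x, v ≠ x → v ∉ Γ := by
    intro x hxΓ v hv hne hvΓ
    exact Finset.disjoint_left.1 (hdisj x hxΓ v hvΓ hne.symm) hv (hx v hvΓ)
  have hactrep : ∀ σ, ∀ x ∈ Γ, Active X τ u σ x ↔ Active X τ u (rep σ) x := by
    intro σ x hxΓ
    have hag : ∀ v ∈ X x, v ≠ x → σ v = rep σ v := fun v hv hne => by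
      simp [hrep, hnot x hxΓ v hv hne]
    constructor
    · intro hA
      exact hloc _ _ x hxΓ hag (Or.inl (by simp [hrep, hxΓ, hA])) hA
    · intro hA
      by_contra hA'
      have : rep σ x = σ x := by simp [hrep, hA']
      exact hA' (hloc _ _ x hxΓ (fun v hv hne => (hag v hv hne).symm) (this ▸ hA.2) hA)
  have hfib : ∀ ρ ∈ Fintype.piFinset t,
      (#{σ ∈ ({σ ∈ Fintype.piFinset t | P σ ∧ good σ} : Finset (V → V)) | rep σ = ρ} : ℝ) ≤
        (K / M ^ 2 : ℝ) ^ h * #{σ ∈ Fintype.piFinset t | rep σ = ρ} := by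
    intro ρ hρ
    rcases (({σ ∈ Fintype.piFinset t | P σ ∧ good σ} : Finset (V → V)).filter
      (rep · = ρ)).eq_empty_or_nonempty with he | ⟨σ₁, hσ₁⟩
    · rw [he]; simp only [card_empty, Nat.cast_zero]; positivity
    simp only [mem_filter] at hσ₁
    obtain ⟨⟨hσ₁t, -, hσ₁g⟩, hσ₁ρ⟩ := hσ₁
    set S : Finset V := {x ∈ Γ | Active X τ u ρ x} with hS
    have hSΓ : S ⊆ Γ := filter_subset _ _
    have hρτ : ∀ x ∈ S, ρ x = τ x := by
      intro x hxS
      obtain ⟨hxΓ, hA⟩ := mem_filter.1 hxS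
      rw [← hσ₁ρ, ← hactrep σ₁ x hxΓ] at hA
      rw [← hσ₁ρ]
      simp [hrep, hxΓ, hA]
    have hSi : ∀ i, M ^ 4 ≤ #{x ∈ S | fam x = i} := by
      intro i
      refine (hσ₁g i).trans (card_le_card fun x hxm => ?_)
      simp only [mem_filter] at hxm
      simp only [hS, mem_filter]
      refine ⟨⟨hxm.1.1, ?_⟩, hxm.1.2⟩
      rw [← hσ₁ρ, ← hactrep σ₁ x hxm.1.1]
      exact hxm.2
    have hsw : ∀ F ⊆ S, switch u ρ F ∈ Fintype.piFinset t ∧ rep (switch u ρ F) = ρ := by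
      intro F hF
      have hA : ∀ x ∈ Γ, Active X τ u ρ x ↔ Active X τ u (switch u ρ F) x := by
        intro x hxΓ
        have hag : ∀ v ∈ X x, v ≠ x → ρ v = switch u ρ F v := fun v hv hne => by
          have : v ∉ F := fun hvF => hnot x hxΓ v hv hne (hSΓ (hF hvF))
          simp [switch, this]
        by_cases hxF : x ∈ F
        · have hAx := (mem_filter.1 (hF hxF)).2
          exact iff_of_true hAx
            (hloc _ _ x hxΓ hag (Or.inr (by simp [switch, hxF])) hAx)
        · have hxe : switch u ρ F x = ρ x := by simp [switch, hxF]
          constructor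
          · exact fun hA => hloc _ _ x hxΓ hag (hxe.symm ▸ hA.2) hA
          · exact fun hA => hloc _ _ x hxΓ (fun v hv hne => (hag v hv hne).symm) (hxe ▸ hA.2) hA
      constructor
      · rw [Fintype.mem_piFinset] at hρ ⊢
        intro v
        by_cases hv : v ∈ F
        · simpa [switch, hv] using hu v (hSΓ (hF hv))
        · simpa [switch, hv] using hρ v
      · funext v
        by_cases hv : v ∈ S
        · obtain ⟨hvΓ, hvA⟩ := mem_filter.1 hv
          simp [hrep, hvΓ, (hA v hvΓ).1 hvA, hρτ v hv]
        · have h1 : ¬ (v ∈ Γ ∧ Active X τ u (switch u ρ F) v) := by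
            rintro ⟨hvΓ, hvA⟩
            exact hv (mem_filter.2 ⟨hvΓ, (hA v hvΓ).2 hvA⟩)
          have h2 : v ∉ F := fun h => hv (hF h)
          simp only [hrep, if_neg h1]
          simp [switch, h2]
    have hlow : 2 ^ #S ≤ #{σ ∈ Fintype.piFinset t | rep σ = ρ} := by
      rw [← card_powerset]
      refine card_le_card_of_injOn (switch u ρ) ?_ ?_
      · intro F hF
        exact mem_filter.2 (hsw F (mem_powerset.1 hF))
      · intro F hF F' hF' he
        ext v
        have hev := congrFun he v
        have key : ∀ F ⊆ S, v ∈ F ↔ v ∈ S ∧ switch u ρ F v ≠ τ v := by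
          intro F hF
          constructor
          · intro hv
            exact ⟨hF hv, by simpa [switch, hv] using huτ v (hSΓ (hF hv))⟩
          · rintro ⟨hvS, hv⟩
            by_contra hvF
            exact hv (by simp [switch, hvF, hρτ v hvS])
        rw [key F (mem_powerset.1 hF), key F' (mem_powerset.1 hF'), hev]
    have hup : #{σ ∈ ({σ ∈ Fintype.piFinset t | P σ ∧ good σ} : Finset (V → V)) | rep σ = ρ} ≤
        #{F ∈ S.powerset | P (switch u ρ F)} := by
      have hrec : ∀ σ, rep σ = ρ → switch u ρ {x ∈ S | σ x ≠ τ x} = σ := by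
        intro σ hσ
        funext v
        by_cases hv : v ∈ S
        · obtain ⟨hvΓ, hvA⟩ := mem_filter.1 hv
          rw [← hσ, ← hactrep σ v hvΓ] at hvA
          by_cases hvτ : σ v = τ v
          · simp [switch, hvτ, hρτ v hv]
          · simp [switch, hv, hvA.2.resolve_left hvτ, huτ v hvΓ]
        · have h1 : ¬ (v ∈ Γ ∧ Active X τ u σ v) := by
            rintro ⟨hvΓ, hvA⟩
            refine hv (mem_filter.2 ⟨hvΓ, ?_⟩)
            rw [← hσ, ← hactrep σ v hvΓ]
            exact hvA
          have h2 : ρ v = σ v := by rw [← hσ]; simp only [hrep, if_neg h1]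
          simp [switch, hv, h2]
      refine card_le_card_of_injOn (fun σ => {x ∈ S | σ x ≠ τ x}) ?_ ?_
      · intro σ hσ
        simp only [mem_coe, mem_filter] at hσ
        simp only [coe_filter, mem_powerset, Set.mem_ofPred_eq]
        refine ⟨filter_subset _ _, ?_⟩
        rw [hrec σ hσ.2]
        exact hσ.1.2.1
      · intro σ hσ σ' hσ' he
        simp only [mem_coe, mem_filter] at hσ hσ'
        rw [← hrec σ hσ.2, ← hrec σ' hσ'.2]
        exact congrArg _ he
    have hcnt := hP ρ hρ S hSΓ (fun x hxS => (mem_filter.1 hxS).2) hρτ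
    have hMpos : (0 : ℝ) < M := by exact_mod_cast hM
    calc (#{σ ∈ ({σ ∈ Fintype.piFinset t | P σ ∧ good σ} : Finset (V → V)) | rep σ = ρ} : ℝ)
        ≤ ∏ i : Fin h, (K * (#{x ∈ S | fam x = i}).choose (#{x ∈ S | fam x = i} / 2) : ℝ) := by
          exact_mod_cast hup.trans hcnt
      _ ≤ ∏ i : Fin h, (K / M ^ 2 * 2 ^ #{x ∈ S | fam x = i} : ℝ) := by
          refine prod_le_prod (fun i _ => by positivity) fun i _ => ?_
          have := choose_half_le (#{x ∈ S | fam x = i}) (M ^ 2)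
            (by rw [← pow_mul]; exact hSi i)
          push_cast at this
          rw [div_mul_eq_mul_div, mul_div_assoc]
          refine mul_le_mul_of_nonneg_left ?_ (by positivity)
          rw [le_div_iff₀ (by positivity)]
          linarith
      _ = (K / M ^ 2 : ℝ) ^ h * 2 ^ #S := by
          rw [prod_mul_distrib, prod_const, card_univ, Fintype.card_fin, prod_pow_eq_pow_sum]
          congr 2
          exact (card_eq_sum_card_fiberwise fun x _ => mem_coe.2 (mem_univ (fam x))).symm
      _ ≤ _ := by
          refine mul_le_mul_of_nonneg_left ?_ (by positivity)
          exact_mod_cast hlow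
  have hgoodle : (#{σ ∈ Fintype.piFinset t | P σ ∧ good σ} : ℝ) ≤
      (K / M ^ 2 : ℝ) ^ h * #(Fintype.piFinset t) := by
    have e1 := card_eq_sum_card_fiberwise (s := {σ ∈ Fintype.piFinset t | P σ ∧ good σ})
      (t := Fintype.piFinset t) (f := rep) fun σ hσ => hmaps σ (mem_filter.1 hσ).1
    have e2 := card_eq_sum_card_fiberwise (s := Fintype.piFinset t)
      (t := Fintype.piFinset t) (f := rep) hmaps
    rw [e1, e2]
    push_cast
    rw [mul_sum]
    exact sum_le_sum hfib
  have hsplit : (#{σ ∈ Fintype.piFinset t | P σ} : ℝ) ≤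
      #{σ ∈ Fintype.piFinset t | P σ ∧ good σ} + #{σ ∈ Fintype.piFinset t | ¬ good σ} := by
    have : ({σ ∈ Fintype.piFinset t | P σ} : Finset (V → V)) ⊆
        {σ ∈ Fintype.piFinset t | P σ ∧ good σ} ∪ {σ ∈ Fintype.piFinset t | ¬ good σ} := by
      intro σ hσ
      obtain ⟨h1, h2⟩ := mem_filter.1 hσ
      by_cases hg : good σ
      · exact mem_union_left _ (mem_filter.2 ⟨h1, h2, hg⟩)
      · exact mem_union_right _ (mem_filter.2 ⟨h1, hg⟩)
    exact_mod_cast (card_le_card this).trans (card_union_le _ _)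
  linarith

/-- The number of vertices of `A` that choose `v`. -/
def load (A : Finset V) (σ : V → V) (v : V) : ℤ := #{x ∈ A | σ x = v}

/-- The shifted loads of the vertices in `B` have level counts `a`. -/
def Fits (A B : Finset V) (a : ℤ → ℤ) (b : V → ℤ) (σ : V → V) : Prop :=
  ∀ k : ℤ, (#{v ∈ B | load A σ v + b v = k} : ℤ) = a k

lemma load_switch (A F : Finset V) (σ w u : V → V) (hF : F ⊆ A) (hσ : ∀ x ∈ F, σ x = w x) (v : V) :
    load A (switch u σ F) v = load A σ v - #{x ∈ F | w x = v} + #{x ∈ F | u x = v} := by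
  have h1 : ∀ f : V → V, (#{x ∈ A | f x = v} : ℤ) =
      #{x ∈ F | f x = v} + #{x ∈ A \ F | f x = v} := by
    intro f
    rw [← Nat.cast_add, ← card_union_of_disjoint, ← filter_union, union_sdiff_of_subset hF]
    exact disjoint_filter_filter disjoint_sdiff
  have h2 : ({x ∈ F | switch u σ F x = v} : Finset V) = {x ∈ F | u x = v} :=
    filter_congr fun x hx => by simp [switch, hx]
  have h3 : ({x ∈ A \ F | switch u σ F x = v} : Finset V) = {x ∈ A \ F | σ x = v} :=
    filter_congr fun x hx => by simp [switch, (mem_sdiff.1 hx).2]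
  have h4 : ({x ∈ F | σ x = v} : Finset V) = {x ∈ F | w x = v} :=
    filter_congr fun x hx => by rw [hσ x hx]
  unfold load
  rw [h1 (switch u σ F), h1 σ, h2, h3, h4]
  ring

lemma card_le_eq_of_card_eq {B : Finset V} {f g : V → ℤ}
    (h : ∀ k, #{v ∈ B | f v = k} = #{v ∈ B | g v = k}) (k : ℤ) :
    #{v ∈ B | k ≤ f v} = #{v ∈ B | k ≤ g v} := by
  have key : ∀ e : V → ℤ, (∀ v ∈ B, e v ∈ B.image f ∪ B.image g) →
      #{v ∈ B | k ≤ e v} =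
        ∑ j ∈ (B.image f ∪ B.image g) with k ≤ j, #{v ∈ B | e v = j} := by
    intro e he
    rw [card_eq_sum_card_fiberwise (f := e) (t := {j ∈ B.image f ∪ B.image g | k ≤ j})]
    · refine sum_congr rfl fun j hj => ?_
      rw [filter_filter]
      congr 1
      refine filter_congr fun v _ => ?_
      have := (mem_filter.1 hj).2
      constructor
      · exact fun h => h.2
      · exact fun h => ⟨h ▸ this, h⟩
    · intro v hv
      obtain ⟨h1, h2⟩ := mem_filter.1 hv
      exact mem_filter.2 ⟨he v h1, h2⟩
  rw [key f fun v hv => mem_union_left _ (mem_image_of_mem f hv),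
    key g fun v hv => mem_union_right _ (mem_image_of_mem g hv)]
  exact sum_congr rfl fun j _ => h j

/-- Effect of a switch on the number of vertices whose shifted load is at least `k`. -/
lemma card_le_load_switch (A B S F : Finset V) (σ w u : V → V) (b : V → ℤ) (hS : S ⊆ A)
    (hσ : ∀ x ∈ S, σ x = w x) (hw : ∀ x ∈ S, w x ∈ B) (hu : ∀ x ∈ S, u x ∈ B)
    (hwi : Set.InjOn w S) (hui : Set.InjOn u S) (hwu : ∀ x ∈ S, ∀ y ∈ S, w x ≠ u y)
    (hF : F ⊆ S) (k : ℤ) :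
    (#{v ∈ B | k ≤ load A (switch u σ F) v + b v} : ℤ) =
      #{v ∈ B | k ≤ load A σ v + b v} - #{x ∈ F | load A σ (w x) + b (w x) = k} +
        #{x ∈ F | load A σ (u x) + b (u x) + 1 = k} := by
  have e1 : #{x ∈ F | load A σ (w x) + b (w x) = k} =
      ∑ v ∈ B, #{x ∈ F | w x = v ∧ load A σ (w x) + b (w x) = k} := by
    rw [card_eq_sum_card_fiberwise (f := w) (t := B) fun x hx => hw x (hF (mem_filter.1 hx).1)]
    refine sum_congr rfl fun v _ => ?_
    rw [filter_filter]
    exact congrArg _ (filter_congr fun x _ => and_comm)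
  have e2 : #{x ∈ F | load A σ (u x) + b (u x) + 1 = k} =
      ∑ v ∈ B, #{x ∈ F | u x = v ∧ load A σ (u x) + b (u x) + 1 = k} := by
    rw [card_eq_sum_card_fiberwise (f := u) (t := B) fun x hx => hu x (hF (mem_filter.1 hx).1)]
    refine sum_congr rfl fun v _ => ?_
    rw [filter_filter]
    exact congrArg _ (filter_congr fun x _ => and_comm)
  rw [e1, e2, card_filter, card_filter]
  push_cast
  rw [← sum_sub_distrib, ← sum_add_distrib]
  refine sum_congr rfl fun v _ => ?_
  rw [load_switch A F σ w u (hF.trans hS) (fun x hx => hσ x (hF hx))]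
  have single : ∀ g : V → V, Set.InjOn g S → ∀ x ∈ F, g x = v →
      ({y ∈ F | g y = v} : Finset V) = {x} := by
    intro g hg x hx hxv
    ext y
    simp only [mem_filter, mem_singleton]
    constructor
    · rintro ⟨hy, hyv⟩
      exact hg (hF hy) (hF hx) (hyv.trans hxv.symm)
    · rintro rfl
      exact ⟨hx, hxv⟩
  simp only [← filter_filter]
  by_cases h1 : ∃ x ∈ F, w x = v
  · obtain ⟨x, hx, hxv⟩ := h1
    have h2 : ({y ∈ F | u y = v} : Finset V) = ∅ := by
      rw [filter_eq_empty_iff]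
      intro y hy hyv
      exact hwu x (hF hx) y (hF hy) (hxv.trans hyv.symm)
    rw [single w hwi x hx hxv, h2, filter_singleton, hxv]
    simp only [card_singleton, card_empty, filter_empty]
    split_ifs <;> simp <;> omega
  · have h1' : ({y ∈ F | w y = v} : Finset V) = ∅ := by
      rw [filter_eq_empty_iff]
      exact fun y hy hyv => h1 ⟨y, hy, hyv⟩
    rw [h1']
    by_cases h2 : ∃ x ∈ F, u x = v
    · obtain ⟨x, hx, hxv⟩ := h2
      rw [single u hui x hx hxv, filter_singleton, hxv]
      simp only [card_singleton, card_empty, filter_empty]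
      split_ifs <;> simp <;> omega
    · have h2' : ({y ∈ F | u y = v} : Finset V) = ∅ := by
        rw [filter_eq_empty_iff]
        exact fun y hy hyv => h2 ⟨y, hy, hyv⟩
      rw [h2']
      simp

open Classical in
/-- If all the switches go in the same direction, then there are few of them leading to the same
level counts. -/
lemma card_switch_fits_le (A B S : Finset V) (a : ℤ → ℤ) (σ w u : V → V) (b p q : V → ℤ)
    (hS : S ⊆ A) (hσ : ∀ x ∈ S, σ x = w x) (hw : ∀ x ∈ S, w x ∈ B) (hu : ∀ x ∈ S, u x ∈ B)
    (hwi : Set.InjOn w S) (hui : Set.InjOn u S) (hwu : ∀ x ∈ S, ∀ y ∈ S, w x ≠ u y)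
    (hp : ∀ x ∈ S, load A σ (w x) + b (w x) = p x)
    (hq : ∀ x ∈ S, load A σ (u x) + b (u x) + 1 = q x)
    (hpq : (∀ x ∈ S, p x < q x) ∨ ∀ x ∈ S, q x < p x) :
    #{F ∈ S.powerset | Fits A B a b (switch u σ F)} ≤
      ∏ z ∈ S.image p, (#{x ∈ S | p x = z}).choose (#{x ∈ S | p x = z} / 2) := by
  set 𝓕 : Finset (Finset V) := {F ∈ S.powerset | Fits A B a b (switch u σ F)} with h𝓕
  have hsub : ∀ F ∈ 𝓕, F ⊆ S := fun F hF => mem_powerset.1 (mem_filter.1 hF).1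
  have hcount : ∀ F ∈ 𝓕, ∀ F' ∈ 𝓕, ∀ z : ℤ,
      (#{x ∈ F | q x = z} : ℤ) - #{x ∈ F | p x = z} =
        #{x ∈ F' | q x = z} - #{x ∈ F' | p x = z} := by
    intro F hF F' hF' z
    have h1 := card_le_eq_of_card_eq (B := B) (f := fun v => load A (switch u σ F) v + b v)
      (g := fun v => load A (switch u σ F') v + b v) (fun k => by
        have e1 := (mem_filter.1 hF).2 k
        have e2 := (mem_filter.1 hF').2 k
        exact_mod_cast e1.trans e2.symm) z
    have h2 := congrArg (Nat.cast : ℕ → ℤ) h1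
    rw [card_le_load_switch A B S F σ w u b hS hσ hw hu hwi hui hwu (hsub F hF),
      card_le_load_switch A B S F' σ w u b hS hσ hw hu hwi hui hwu (hsub F' hF')] at h2
    have conv : ∀ F ∈ 𝓕, #{x ∈ F | load A σ (w x) + b (w x) = z} = #{x ∈ F | p x = z} ∧
        #{x ∈ F | load A σ (u x) + b (u x) + 1 = z} = #{x ∈ F | q x = z} := fun F hF =>
      ⟨congrArg _ (filter_congr fun x hx => by rw [hp x (hsub F hF hx)]),
        congrArg _ (filter_congr fun x hx => by rw [hq x (hsub F hF hx)])⟩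
    rw [(conv F hF).1, (conv F hF).2, (conv F' hF').1, (conv F' hF').2] at h2
    linarith
  have main : ∀ r : V → ℤ, (∀ z, ∀ F ∈ 𝓕, ∀ F' ∈ 𝓕,
      ({x ∈ F | r x < z} : Finset V) = ({x ∈ F' | r x < z} : Finset V) →
      #{x ∈ F | r x = z} = #{x ∈ F' | r x = z}) →
      #𝓕 ≤ ∏ z ∈ S.image r, (#{x ∈ S | r x = z}).choose (#{x ∈ S | r x = z} / 2) := by
    intro r hr
    refine (card_family_le r 1 S 𝓕 hsub ?_).trans (le_of_eq (by simp))
    intro z G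
    rw [card_le_one]
    intro c hc c' hc'
    obtain ⟨F, hF, rfl⟩ := mem_image.1 hc
    obtain ⟨F', hF', rfl⟩ := mem_image.1 hc'
    obtain ⟨h1, h2⟩ := mem_filter.1 hF
    obtain ⟨h3, h4⟩ := mem_filter.1 hF'
    exact hr z F h1 F' h3 (h2.trans h4.symm)
  rcases hpq with hpq | hpq
  · refine main p fun z F hF F' hF' he => ?_
    have hqe : ∀ F ∈ 𝓕, ({x ∈ F | q x = z} : Finset V) =
        {x ∈ ({x ∈ F | p x < z} : Finset V) | q x = z} := by
      intro F hF
      rw [filter_filter]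
      refine filter_congr fun x hx => ?_
      have := hpq x (hsub F hF hx)
      constructor
      · intro h; exact ⟨h ▸ this, h⟩
      · exact fun h => h.2
    have := hcount F hF F' hF' z
    rw [hqe F hF, hqe F' hF', he] at this
    omega
  · have h := main (fun x => - p x) fun z F hF F' hF' he => by
      have hqe : ∀ F ∈ 𝓕, ({x ∈ F | q x = -z} : Finset V) =
          {x ∈ ({x ∈ F | - p x < z} : Finset V) | q x = -z} := by
        intro F hF
        rw [filter_filter]
        refine filter_congr fun x hx => ?_
        have := hpq x (hsub F hF hx)
        constructor
        · intro h; exact ⟨by omega, h⟩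
        · exact fun h => h.2
      have := hcount F hF F' hF' (-z)
      rw [hqe F hF, hqe F' hF', he] at this
      simp only [neg_eq_iff_eq_neg]
      omega
    refine h.trans (le_of_eq ?_)
    have himg : S.image (fun x => - p x) = (S.image p).image (fun z => -z) := by
      rw [image_image]; rfl
    rw [himg, prod_image (neg_injective.injOn)]
    simp only [neg_inj]

lemma prod_image_le_prod_of_mem {h : ℕ} {S : Finset V} {p : V → ℤ} {fam : V → Fin h} {c : Fin h → ℤ}
    (hc : Function.Injective c) (hp : ∀ x ∈ S, p x = c (fam x)) (K : ℕ) (hK : 1 ≤ K) :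
    ∏ z ∈ S.image p, K * (#{x ∈ S | p x = z}).choose (#{x ∈ S | p x = z} / 2) ≤
      ∏ i, K * (#{x ∈ S | fam x = i}).choose (#{x ∈ S | fam x = i} / 2) := by
  have h1 : S.image p ⊆ univ.image c := by
    intro z hz
    obtain ⟨x, hx, rfl⟩ := mem_image.1 hz
    exact mem_image.2 ⟨fam x, mem_univ _, (hp x hx).symm⟩
  refine (prod_le_prod_of_subset_of_one_le' h1 fun z _ _ => ?_).trans (le_of_eq ?_)
  · exact Nat.mul_pos hK (Nat.choose_pos (Nat.div_le_self _ _))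
  · rw [prod_image hc.injOn]
    refine prod_congr rfl fun i _ => ?_
    have : ({x ∈ S | p x = c i} : Finset V) = {x ∈ S | fam x = i} :=
      filter_congr fun x hx => by rw [hp x hx, hc.eq_iff]
    rw [this]

open Classical in
/-- The anticoncentration bound when there are `h` disjoint pairs in `B`, each with many common
neighbours. -/
lemma card_fits_le_of_pairs (A B : Finset V) (a : ℤ → ℤ) (b : V → ℤ) (t : V → Finset V)
    (M Q h : ℕ) (hM : 1 ≤ M) (hQ1 : 1 ≤ Q) (hh : 1 ≤ h) (Y : Fin h → Finset V) (w u : Fin h → V)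
    (hYA : ∀ i, Y i ⊆ A) (hY : ∀ i j, i ≠ j → Disjoint (Y i) (Y j))
    (hw : ∀ i, w i ∈ B) (hwi : Function.Injective w) (hwu : ∀ i j, w i ≠ u j)
    (hwt : ∀ i, ∀ x ∈ Y i, w i ∈ t x) (hut : ∀ i, ∀ x ∈ Y i, u i ∈ t x)
    (hQ : ∀ i, ∀ x ∈ Y i, #(t x) ≤ Q) (hN : ∀ i, 4 * Q * M ^ 4 ≤ #(Y i)) :
    (#{σ ∈ Fintype.piFinset t | Fits A B a b σ} : ℝ) ≤
      (((2 * h : ℕ) / M ^ 2 : ℝ) ^ h + h * Real.exp (-(M ^ 4 : ℕ))) * #(Fintype.piFinset t) := by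
  set Γ : Finset V := univ.biUnion Y with hΓ
  have hex : ∀ x : V, ∃ i : Fin h, x ∈ Γ → x ∈ Y i := by
    intro x
    by_cases hx : x ∈ Γ
    · obtain ⟨i, -, hi⟩ := mem_biUnion.1 hx
      exact ⟨i, fun _ => hi⟩
    · exact ⟨⟨0, hh⟩, fun h => absurd h hx⟩
  choose fam hfam using hex
  have hfam_eq : ∀ i, ({x ∈ Γ | fam x = i} : Finset V) = Y i := by
    intro i
    ext x
    simp only [mem_filter]
    constructor
    · rintro ⟨hx, rfl⟩; exact hfam x hx
    · intro hx
      have hxΓ : x ∈ Γ := mem_biUnion.2 ⟨i, mem_univ _, hx⟩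
      refine ⟨hxΓ, ?_⟩
      by_contra hne
      exact Finset.disjoint_left.1 (hY _ _ hne) (hfam x hxΓ) hx
  refine card_filter_le_of_gadgets _ t (fun x => {x}) (fun x => w (fam x)) (fun x => u (fam x))
    (2 * h) M Q h hM Γ fam (fun x _ => mem_singleton_self x)
    (fun x _ y _ hxy => disjoint_singleton.2 hxy) ?_ (fun x hx => hut _ x (hfam x hx))
    (fun x _ => (hwu _ _).symm) ?_ hQ1 (fun i => by rw [hfam_eq]; exact hN i) ?_
  · intro x hx v hv
    rw [mem_singleton.1 hv]
    exact hwt _ x (hfam x hx)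
  · intro x hx
    rw [prod_singleton]
    exact hQ _ x (hfam x hx)
  intro σ _ S hS _ hσ
  have hSA : S ⊆ A := fun x hx => hYA _ (hfam x (hS hx))
  refine le_trans (card_family_le (fun x => ((fam x : ℕ) : ℤ)) (2 * h) S _
    (fun F hF => mem_powerset.1 (mem_filter.1 hF).1) ?_)
    (prod_image_le_prod_of_mem (c := fun i : Fin h => ((i : ℕ) : ℤ))
      (fun i j hij => Fin.ext (Nat.cast_injective (R := ℤ) hij)) (fun x _ => rfl) _ (by omega))
  intro z G
  set 𝓕 : Finset (Finset V) := {F ∈ S.powerset | Fits A B a b (switch (fun x => u (fam x)) σ F)}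
    with h𝓕
  refine (card_le_card (image_subset_image (filter_subset _ _))).trans ?_
  by_cases hz : ∃ i : Fin h, ((i : ℕ) : ℤ) = z
  swap
  · refine (card_le_card (t := {0}) ?_).trans (by simp; omega)
    intro c hc
    obtain ⟨F, -, rfl⟩ := mem_image.1 hc
    rw [mem_singleton, card_eq_zero, filter_eq_empty_iff]
    exact fun x _ hx => hz ⟨fam x, hx⟩
  obtain ⟨i, rfl⟩ := hz
  rcases 𝓕.eq_empty_or_nonempty with he | ⟨F₁, hF₁⟩
  · rw [he]; simp
  set W : Finset V := univ.image w ∪ univ.image u with hW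
  have hWcard : #W ≤ 2 * h := by
    refine (card_union_le _ _).trans ?_
    have h1 := card_image_le (s := (univ : Finset (Fin h))) (f := w)
    have h2 := card_image_le (s := (univ : Finset (Fin h))) (f := u)
    simp only [card_univ, Fintype.card_fin] at h1 h2
    omega
  set f : Finset V → V → ℤ := fun F v => load A (switch (fun x => u (fam x)) σ F) v + b v with hf
  have hload : ∀ F ∈ 𝓕, ∀ v, f F v = load A σ v + b v - #{x ∈ F | w (fam x) = v} +
      #{x ∈ F | u (fam x) = v} := by
    intro F hF v
    have hFS : F ⊆ S := mem_powerset.1 (mem_filter.1 hF).1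
    simp only [hf]
    rw [load_switch A F σ (fun x => w (fam x)) _ (hFS.trans hSA) fun x hx => hσ x (hFS hx)]
    ring
  have hout : ∀ F ∈ 𝓕, ∀ v ∉ W, f F v = load A σ v + b v := by
    intro F hF v hv
    rw [hload F hF, filter_eq_empty_iff.2, filter_eq_empty_iff.2]
    · simp
    · rintro x _ rfl
      exact hv (mem_union_right _ (mem_image_of_mem u (mem_univ _)))
    · rintro x _ rfl
      exact hv (mem_union_left _ (mem_image_of_mem w (mem_univ _)))
  have hin : ∀ F ∈ 𝓕, f F (w i) ∈ W.image (f F₁) := by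
    intro F hF
    by_contra hcon
    have hne : ∀ v ∈ W, f F₁ v ≠ f F (w i) := fun v hv h => hcon (mem_image.2 ⟨v, hv, h⟩)
    have hcard : #{v ∈ B | f F v = f F (w i)} = #{v ∈ B | f F₁ v = f F (w i)} := by
      have e1 := (mem_filter.1 hF).2 (f F (w i))
      have e2 := (mem_filter.1 hF₁).2 (f F (w i))
      exact_mod_cast e1.trans e2.symm
    refine absurd hcard (ne_of_gt (card_lt_card ?_))
    rw [ssubset_iff_of_subset]
    · refine ⟨w i, mem_filter.2 ⟨hw i, rfl⟩, fun h => ?_⟩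
      exact hne (w i) (mem_union_left _ (mem_image_of_mem w (mem_univ _))) (mem_filter.1 h).2
    · intro v hv
      obtain ⟨hvB, hv⟩ := mem_filter.1 hv
      have hvW : v ∉ W := fun h => hne v h hv
      refine mem_filter.2 ⟨hvB, ?_⟩
      rw [hout F hF v hvW, ← hout F₁ hF₁ v hvW, hv]
  rw [← card_image_of_injective _ (Nat.cast_injective (R := ℤ)), image_image]
  refine (card_le_card (t := (W.image (f F₁)).image fun y => load A σ (w i) + b (w i) - y) ?_).trans
    (card_image_le.trans (card_image_le.trans hWcard))
  intro c hc
  obtain ⟨F, hF, rfl⟩ := mem_image.1 hc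
  refine mem_image.2 ⟨_, hin F hF, ?_⟩
  have h1 : ({x ∈ F | u (fam x) = w i} : Finset V) = ∅ :=
    filter_eq_empty_iff.2 fun x _ h => hwu _ _ h.symm
  have h2 : ({x ∈ F | w (fam x) = w i} : Finset V) = {x ∈ F | ((fam x : ℕ) : ℤ) = (i : ℕ)} := by
    refine filter_congr fun x _ => ?_
    rw [hwi.eq_iff]
    constructor
    · intro h; rw [h]
    · intro h; exact Fin.ext (by exact_mod_cast h)
  rw [hload F hF, h1, h2]
  simp

lemma exists_families (s : Finset V) (h N : ℕ) (hh : 1 ≤ h) (hs : h * N ≤ #s) :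
    ∃ f : V → Fin h, ∀ i, N ≤ #{x ∈ s | f x = i} := by
  let e := s.equivFin
  refine ⟨fun x => if hx : x ∈ s then ⟨(e ⟨x, hx⟩ : ℕ) % h, Nat.mod_lt _ hh⟩ else ⟨0, hh⟩,
    fun i => ?_⟩
  have hlt : ∀ k : Fin N, (k : ℕ) * h + i < #s := fun k => by
    have h1 : ((k : ℕ) + 1) * h ≤ N * h := Nat.mul_le_mul_right _ k.2
    have h2 := i.2
    nlinarith
  rw [← Fintype.card_fin N, ← card_univ]
  refine card_le_card_of_injOn (fun k => (e.symm ⟨k * h + i, hlt k⟩ : V)) ?_ ?_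
  · intro k _
    simp only [coe_filter, Set.mem_ofPred_eq]
    refine ⟨(e.symm _).2, ?_⟩
    simp [Nat.mod_eq_of_lt i.2]
  · intro k _ k' _ hk
    have h1 := e.symm.injective (Subtype.ext hk)
    simp only [Fin.mk.injEq] at h1
    have h2 : (k : ℕ) * h = k' * h := by omega
    exact Fin.ext (Nat.eq_of_mul_eq_mul_right hh h2)

lemma exists_template (t : V → Finset V) (X : Finset V) (x w u : V) (j : ℕ) (hx : x ∈ X)
    (hw : ∀ v ∈ X, w ∈ t v) (hwu : u ≠ w) (h3 : ∀ v ∈ X, 3 ≤ #(t v)) (hj1 : 1 ≤ j)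
    (hj : j ≤ #X) :
    ∃ τ : V → V, (∀ v ∈ X, τ v ∈ t v) ∧ τ x = w ∧ #{v ∈ X | τ v = w} = j ∧
      ∀ v ∈ X, τ v ≠ u := by
  obtain ⟨Y, hxY, hYX, hY⟩ := exists_subsuperset_card_eq (s := {x}) (t := X)
    (singleton_subset_iff.2 hx) (n := j) (by simpa using hj1) hj
  have hy : ∀ v, ∃ y, v ∈ X → y ∈ t v ∧ y ≠ w ∧ y ≠ u := by
    intro v
    by_cases hv : v ∈ X
    · obtain ⟨y, hy, hyn⟩ := exists_mem_notMem_of_card_lt_card (s := {w, u}) (t := t v)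
        (lt_of_le_of_lt card_le_two (h3 v hv))
      simp only [mem_insert, mem_singleton, not_or] at hyn
      exact ⟨y, fun _ => ⟨hy, hyn⟩⟩
    · exact ⟨v, fun h => absurd h hv⟩
  choose y hy using hy
  refine ⟨fun v => if v ∈ Y then w else y v, ?_, ?_, ?_, ?_⟩
  · intro v hv
    dsimp only
    split_ifs
    · exact hw v hv
    · exact (hy v hv).1
  · simp [singleton_subset_iff.1 hxY]
  · rw [← hY]
    congr 1
    ext v
    simp only [mem_filter]
    constructor
    · rintro ⟨hv, he⟩
      by_contra hvY
      rw [if_neg hvY] at he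
      exact (hy v hv).2.1 he
    · intro hv
      exact ⟨hYX hv, if_pos hv⟩
  · intro v hv
    dsimp only
    split_ifs
    · exact hwu.symm
    · exact (hy v hv).2.2

/-- Among sufficiently many points, many share a value of `s` or many have distinct values. -/
lemma exists_constant_or_injOn (Γ : Finset V) (s : V → ℤ) (R : ℕ) (hR : R ^ 2 ≤ #Γ) :
    ∃ Γ' ⊆ Γ, R ≤ #Γ' ∧ ((∀ x ∈ Γ', ∀ y ∈ Γ', s x = s y) ∨ Set.InjOn s Γ') := by
  by_cases hz : ∃ z, R ≤ #{x ∈ Γ | s x = z}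
  · obtain ⟨z, hz⟩ := hz
    refine ⟨_, filter_subset _ _, hz, Or.inl fun x hx y hy => ?_⟩
    rw [(mem_filter.1 hx).2, (mem_filter.1 hy).2]
  · push Not at hz
    obtain ⟨Y, hY, hbij⟩ := Set.exists_subset_bijOn (Γ : Set V) s
    lift Y to Finset V using Γ.finite_toSet.subset hY
    refine ⟨Y, coe_subset.1 hY, ?_, Or.inr hbij.injOn⟩
    have himg : Y.image s = Γ.image s := by
      apply coe_injective
      rw [coe_image, coe_image, hbij.image_eq]
    rw [← card_image_of_injOn hbij.injOn, himg]
    by_contra hlt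
    have h1 := card_le_mul_card_image (f := s) Γ R fun z _ => (hz z).le
    have h2 : R * #(Γ.image s) < R * R :=
      Nat.mul_lt_mul_of_pos_left (not_le.1 hlt) (by omega)
    nlinarith

open Classical in
/-- The anticoncentration bound when the only random choices are made in blocks with a common
neighbour each, and the blocks have no interaction. -/
lemma card_fits_le_of_blocks (A B : Finset V) (a : ℤ → ℤ) (b : V → ℤ) (t : V → Finset V)
    (M Q h : ℕ) (hM : 1 ≤ M) (hQ1 : 1 ≤ Q) (hh : 1 ≤ h) (Γ : Finset V) (X : V → Finset V)
    (w u : V → V) (hXA : ∀ x ∈ Γ, X x ⊆ A) (hx : ∀ x ∈ Γ, x ∈ X x) (hX : ∀ x ∈ Γ, #(X x) = 2 * h)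
    (hwt : ∀ x ∈ Γ, ∀ v ∈ X x, w x ∈ t v) (h3 : ∀ x ∈ Γ, ∀ v ∈ X x, 3 ≤ #(t v))
    (hut : ∀ x ∈ Γ, u x ∈ t x) (huw : ∀ x ∈ Γ, u x ≠ w x)
    (hw : ∀ x ∈ Γ, w x ∈ B) (hu : ∀ x ∈ Γ, u x ∈ B)
    (hfree : ∀ x ∈ Γ, ∀ y ∈ Γ, x ≠ y → ∀ v ∈ X y, w x ∉ t v ∧ u x ∉ t v)
    (hfix : ∀ y ∈ A \ Γ.biUnion X, #(t y) ≤ 1)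
    (hQ : ∀ x ∈ Γ, ∏ v ∈ X x, #(t v) ≤ Q) (hΓ : 2 * (h * (4 * Q * M ^ 4)) ^ 2 ≤ #Γ) :
    (#{σ ∈ Fintype.piFinset t | Fits A B a b σ} : ℝ) ≤
      (((1 : ℕ) / M ^ 2 : ℝ) ^ h + h * Real.exp (-(M ^ 4 : ℕ))) * #(Fintype.piFinset t) := by
  rcases (Fintype.piFinset t).eq_empty_or_nonempty with h0 | ⟨σ₀, hσ₀⟩
  · rw [h0]; simp
  rw [Fintype.mem_piFinset] at hσ₀
  set U := Γ.biUnion X with hU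
  set base : V → ℤ := fun v => #{y ∈ A \ U | σ₀ y = v} with hbase
  have hdisj : ∀ x ∈ Γ, ∀ y ∈ Γ, x ≠ y → Disjoint (X x) (X y) := fun x hxΓ y hyΓ hne =>
    Finset.disjoint_left.2 fun v hv hv' => (hfree x hxΓ y hyΓ hne v hv').1 (hwt x hxΓ v hv)
  have hUA : U ⊆ A := biUnion_subset.2 hXA
  have hload : ∀ σ ∈ Fintype.piFinset t, ∀ x ∈ Γ, ∀ z, (z = w x ∨ z = u x) →
      load A σ z = base z + #{y ∈ X x | σ y = z} := by
    intro σ hσ x hxΓ z hz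
    rw [Fintype.mem_piFinset] at hσ
    have e1 : ({y ∈ A | σ y = z} : Finset V) = {y ∈ A \ U | σ y = z} ∪ {y ∈ U | σ y = z} := by
      rw [← filter_union, sdiff_union_of_subset hUA]
    have e2 : ({y ∈ A \ U | σ y = z} : Finset V) = {y ∈ A \ U | σ₀ y = z} :=
      filter_congr fun y hy => by
        rw [card_le_one.1 (hfix y hy) _ (hσ y) _ (hσ₀ y)]
    have e3 : ({y ∈ U | σ y = z} : Finset V) = {y ∈ X x | σ y = z} := by
      ext y
      simp only [mem_filter, hU, mem_biUnion]
      constructor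
      · rintro ⟨⟨x', hx', hy⟩, rfl⟩
        refine ⟨?_, rfl⟩
        by_contra hyx
        have hne : x ≠ x' := by rintro rfl; exact hyx hy
        have := hfree x hxΓ x' hx' hne y hy
        rcases hz with hz | hz
        · exact this.1 (hz ▸ hσ y)
        · exact this.2 (hz ▸ hσ y)
      · rintro ⟨hy, rfl⟩
        exact ⟨⟨x, hxΓ, hy⟩, rfl⟩
    rw [load, e1, card_union_of_disjoint (disjoint_filter_filter sdiff_disjoint), e2, e3]
    push_cast
    rfl
  set s : V → ℤ := fun x => base (w x) + b (w x) with hs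
  set q : V → ℤ := fun x => base (u x) + b (u x) + 1 with hq
  obtain ⟨o, Γ₁, hΓ₁, hoh, hcard, hor⟩ : ∃ o : ℕ, ∃ Γ₁ ⊆ Γ, o ≤ h ∧
      (h * (4 * Q * M ^ 4)) ^ 2 ≤ #Γ₁ ∧
      ((o = 0 ∧ ∀ x ∈ Γ₁, s x + h < q x) ∨ (o = h ∧ ∀ x ∈ Γ₁, q x ≤ s x + h)) := by
    have hsum := card_filter_add_card_filter_not (s := Γ) (fun x => s x + h < q x)
    by_cases hc : (h * (4 * Q * M ^ 4)) ^ 2 ≤ #{x ∈ Γ | s x + h < q x}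
    · exact ⟨0, _, filter_subset _ _, Nat.zero_le _, hc,
        Or.inl ⟨rfl, fun x hx => (mem_filter.1 hx).2⟩⟩
    · exact ⟨h, _, filter_subset (fun x => ¬ s x + h < q x) _, le_rfl, by omega,
        Or.inr ⟨rfl, fun x hx => not_lt.1 (mem_filter.1 hx).2⟩⟩
  obtain ⟨Γ₂, hΓ₂, hcard₂, hcase⟩ := exists_constant_or_injOn Γ₁ s _ hcard
  obtain ⟨fam, hfam⟩ := exists_families Γ₂ h _ hh hcard₂
  have hΓ₂Γ : Γ₂ ⊆ Γ := hΓ₂.trans hΓ₁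
  obtain ⟨j, hj1, hj2, hprod⟩ : ∃ j : V → ℕ, (∀ x, o + 1 ≤ j x) ∧ (∀ x, j x ≤ o + h) ∧
      ∀ S ⊆ Γ₂, ∏ z ∈ S.image (fun x => s x + j x),
        (#{x ∈ S | s x + j x = z}).choose (#{x ∈ S | s x + j x = z} / 2) ≤
        ∏ i, 1 * (#{x ∈ S | fam x = i}).choose (#{x ∈ S | fam x = i} / 2) := by
    rcases hcase with hconst | hinj
    · refine ⟨fun x => o + 1 + fam x, fun x => by dsimp only; omega,
        fun x => by have := (fam x).2; dsimp only; omega,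
        fun S hS => ?_⟩
      rcases S.eq_empty_or_nonempty with rfl | ⟨x₀, hx₀⟩
      · simp
      have := prod_image_le_prod_of_mem (S := S)
        (p := fun x => s x + ((o + 1 + fam x : ℕ) : ℤ)) (fam := fam)
        (c := fun i => s x₀ + ((o + 1 + i : ℕ) : ℤ))
        (fun i i' hi => Fin.ext (by
          have : s x₀ + ((o + 1 + i : ℕ) : ℤ) = s x₀ + ((o + 1 + i' : ℕ) : ℤ) := hi
          omega))
        (fun x hx => by simp only [hconst x (hS hx) x₀ (hS hx₀)]) 1 le_rfl
      simpa only [one_mul] using this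
    · refine ⟨fun x => o + 1, fun x => le_rfl, fun x => by dsimp only; omega, fun S hS => ?_⟩
      have h1 : ∀ i ∈ (univ : Finset (Fin h)),
          1 ≤ 1 * (#{x ∈ S | fam x = i}).choose (#{x ∈ S | fam x = i} / 2) := fun i _ => by
        rw [one_mul]; exact Nat.choose_pos (Nat.div_le_self _ _)
      refine le_trans (le_of_eq (prod_eq_one fun z hz => ?_)) (one_le_prod' h1)
      have hle : #{x ∈ S | s x + ((o + 1 : ℕ) : ℤ) = z} ≤ 1 :=
        card_le_one.2 fun x hx y hy => hinj (hS (mem_filter.1 hx).1) (hS (mem_filter.1 hy).1)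
          (by linarith [(mem_filter.1 hx).2, (mem_filter.1 hy).2])
      interval_cases #{x ∈ S | s x + ((o + 1 : ℕ) : ℤ) = z} <;> rfl
  have htpl : ∀ x, ∃ τ : V → V, x ∈ Γ → (∀ v ∈ X x, τ v ∈ t v) ∧ τ x = w x ∧
      #{v ∈ X x | τ v = w x} = j x ∧ ∀ v ∈ X x, τ v ≠ u x := by
    intro x
    by_cases hxΓ : x ∈ Γ
    · obtain ⟨τ, hτ⟩ := exists_template t (X x) x (w x) (u x) (j x) (hx x hxΓ) (hwt x hxΓ)
        (huw x hxΓ) (h3 x hxΓ) (by have := hj1 x; omega)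
        (by have := hj2 x; rw [hX x hxΓ]; omega)
      exact ⟨τ, fun _ => hτ⟩
    · exact ⟨id, fun h => absurd h hxΓ⟩
  choose T hT using htpl
  have hown : ∀ v, ∃ x, v ∈ U → x ∈ Γ ∧ v ∈ X x := by
    intro v
    by_cases hv : v ∈ U
    · obtain ⟨x, hxΓ, hvx⟩ := mem_biUnion.1 hv
      exact ⟨x, fun _ => ⟨hxΓ, hvx⟩⟩
    · exact ⟨v, fun h => absurd h hv⟩
  choose own hown using hown
  have hown_eq : ∀ x ∈ Γ, ∀ v ∈ X x, own v = x := by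
    intro x hxΓ v hv
    obtain ⟨h1, h2⟩ := hown v (mem_biUnion.2 ⟨x, hxΓ, hv⟩)
    by_contra hne
    exact Finset.disjoint_left.1 (hdisj _ h1 x hxΓ hne) h2 hv
  set τ : V → V := fun v => T (own v) v with hτ
  have hτ_eq : ∀ x ∈ Γ, ∀ v ∈ X x, τ v = T x v := fun x hxΓ v hv => by
    simp only [hτ, hown_eq x hxΓ v hv]
  have hτx : ∀ x ∈ Γ, τ x = w x := fun x hxΓ => by
    rw [hτ_eq x hxΓ x (hx x hxΓ)]; exact (hT x hxΓ).2.1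
  refine card_filter_le_of_gadgets _ t X τ u 1 M Q h hM Γ₂ fam (fun x hx' => hx x (hΓ₂Γ hx'))
    (fun x hx' y hy' => hdisj x (hΓ₂Γ hx') y (hΓ₂Γ hy')) ?_ (fun x hx' => hut x (hΓ₂Γ hx')) ?_
    (fun x hx' => hQ x (hΓ₂Γ hx')) hQ1 hfam ?_
  · intro x hx' v hv
    rw [hτ_eq x (hΓ₂Γ hx') v hv]
    exact (hT x (hΓ₂Γ hx')).1 v hv
  · intro x hx'
    rw [hτx x (hΓ₂Γ hx')]
    exact huw x (hΓ₂Γ hx')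
  intro σ hσ S hS hact hστ
  have hSΓ : S ⊆ Γ := hS.trans hΓ₂Γ
  have hσX : ∀ x ∈ S, ∀ v ∈ X x, σ v = T x v := by
    intro x hxS v hv
    rw [← hτ_eq x (hSΓ hxS) v hv]
    by_cases hvx : v = x
    · rw [hvx]; exact hστ x hxS
    · exact (hact x hxS).1 v hv hvx
  refine le_trans (card_switch_fits_le A B S a σ w u b (fun x => s x + j x) q
    (fun x hxS => hXA x (hSΓ hxS) (hx x (hSΓ hxS)))
    (fun x hxS => by rw [hστ x hxS, hτx x (hSΓ hxS)])
    (fun x hxS => hw x (hSΓ hxS)) (fun x hxS => hu x (hSΓ hxS)) ?_ ?_ ?_ ?_ ?_ ?_) (hprod S hS)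
  · intro x hxS y hyS hxy
    by_contra hne
    exact (hfree x (hSΓ hxS) y (hSΓ hyS) hne y (hx y (hSΓ hyS))).1
      (hxy ▸ hwt y (hSΓ hyS) y (hx y (hSΓ hyS)))
  · intro x hxS y hyS hxy
    by_contra hne
    exact (hfree x (hSΓ hxS) y (hSΓ hyS) hne y (hx y (hSΓ hyS))).2 (hxy ▸ hut y (hSΓ hyS))
  · intro x hxS y hyS hxy
    by_cases hne : x = y
    · subst hne; exact huw x (hSΓ hxS) hxy.symm
    · exact (hfree x (hSΓ hxS) y (hSΓ hyS) hne y (hx y (hSΓ hyS))).1 (hxy ▸ hut y (hSΓ hyS))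
  · intro x hxS
    rw [hload σ hσ x (hSΓ hxS) _ (Or.inl rfl)]
    have : ({y ∈ X x | σ y = w x} : Finset V) = {y ∈ X x | T x y = w x} :=
      filter_congr fun y hy => by rw [hσX x hxS y hy]
    rw [this, (hT x (hSΓ hxS)).2.2.1]
    simp only [hs]
    ring
  · intro x hxS
    rw [hload σ hσ x (hSΓ hxS) _ (Or.inr rfl)]
    have : ({y ∈ X x | σ y = u x} : Finset V) = ∅ :=
      filter_eq_empty_iff.2 fun y hy => by
        rw [hσX x hxS y hy]; exact (hT x (hSΓ hxS)).2.2.2 y hy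
    rw [this]
    simp [hq]
  · rcases hor with ⟨ho, h1⟩ | ⟨ho, h1⟩
    · left
      intro x hxS
      have := h1 x (hΓ₂ (hS hxS))
      have := hj2 x
      omega
    · right
      intro x hxS
      have := h1 x (hΓ₂ (hS hxS))
      have := hj1 x
      omega

lemma exists_pairwise_of_forall_extend {α : Type*} (P : α → Prop) (R : α → α → Prop)
    (hR : ∀ x y, R x y → R y x) (K : ℕ)
    (hext : ∀ k < K, ∀ f : Fin k → α, (∀ i, P (f i)) → ∃ x, P x ∧ ∀ i, R (f i) x) :
    ∃ f : Fin K → α, (∀ i, P (f i)) ∧ ∀ i j, i ≠ j → R (f i) (f j) := by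
  have key : ∀ k ≤ K, ∃ f : Fin k → α, (∀ i, P (f i)) ∧ ∀ i j, i ≠ j → R (f i) (f j) := by
    intro k
    induction k with
    | zero => exact fun _ => ⟨fun i => i.elim0, fun i => i.elim0, fun i => i.elim0⟩
    | succ k ih =>
      intro hk
      obtain ⟨f, hP, hf⟩ := ih (by omega)
      obtain ⟨x, hx, hxf⟩ := hext k (by omega) f hP
      refine ⟨Fin.cons x f, ?_, ?_⟩
      · intro i
        refine Fin.cases ?_ (fun i => ?_) i
        · simpa using hx
        · simpa using hP i
      · intro i j
        refine Fin.cases ?_ (fun i => ?_) i <;> refine Fin.cases ?_ (fun j => ?_) j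
        · intro hne; exact absurd rfl hne
        · intro _; simpa using hR _ _ (hxf j)
        · intro _; simpa using hxf i
        · intro hne; simpa using hf i j (fun h => hne (by rw [h]))
  exact key K le_rfl

open Classical in
/-- The anticoncentration bound when many vertices have half of their neighbours in a small
set `H`. -/
lemma card_fits_le_of_small (A B : Finset V) (a : ℤ → ℤ) (b : V → ℤ) (t : V → Finset V)
    (M d h : ℕ) (hM : 1 ≤ M) (hh : 1 ≤ h) (hd : 16 * h ≤ d) (ht : ∀ v ∈ A, #(t v) = d)
    (H : Finset V) (hHB : H ⊆ B) (hH : #A ≤ 2 * #{v ∈ A | d ≤ 2 * #(t v ∩ H)})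
    (hsize : 2 * ((h + #H * #H) * (4 * d * M ^ 4)) ≤ #A) :
    (#{σ ∈ Fintype.piFinset t | Fits A B a b σ} : ℝ) ≤
      (((2 * h : ℕ) / M ^ 2 : ℝ) ^ h + h * Real.exp (-(M ^ 4 : ℕ))) * #(Fintype.piFinset t) := by
  set N := 4 * d * M ^ 4 with hN
  have hN1 : 1 ≤ N := Nat.mul_pos (by omega) (Nat.pow_pos hM)
  refine (exists_pairwise_of_forall_extend
    (fun z : Finset V × V × V => z.1 ⊆ A ∧ #z.1 = N ∧ z.2.1 ∈ B ∧ z.2.1 ≠ z.2.2 ∧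
      ∀ x ∈ z.1, z.2.1 ∈ t x ∧ z.2.2 ∈ t x)
    (fun z z' => Disjoint z.1 z'.1 ∧ Disjoint ({z.2.1, z.2.2} : Finset V) {z'.2.1, z'.2.2})
    (fun z z' hz => ⟨hz.1.symm, hz.2.symm⟩) h ?_).elim ?_
  swap
  · rintro f ⟨hP, hR⟩
    have hwu : ∀ i j, (f i).2.1 ≠ (f j).2.2 := by
      intro i j hij
      by_cases hne : i = j
      · subst hne; exact (hP i).2.2.2.1 hij
      · exact Finset.disjoint_left.1 (hR i j hne).2 (mem_insert_self _ _) (by simp [hij])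
    refine card_fits_le_of_pairs A B a b t M d h hM (by omega) hh (fun i => (f i).1)
      (fun i => (f i).2.1) (fun i => (f i).2.2) (fun i => (hP i).1) (fun i j hij => (hR i j hij).1)
      (fun i => (hP i).2.2.1) ?_ hwu (fun i x hx => ((hP i).2.2.2.2 x hx).1)
      (fun i x hx => ((hP i).2.2.2.2 x hx).2) (fun i x hx => (ht x ((hP i).1 hx)).le)
      (fun i => (hP i).2.1.ge)
    intro i j hij
    by_contra hne
    exact Finset.disjoint_left.1 (hR i j hne).2 (mem_insert_self _ _)
      (mem_insert.2 (Or.inl hij))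
  clear_value N
  intro k hk f hP
  set Y : Finset V := univ.biUnion fun i => (f i).1 with hY
  set W : Finset V := univ.biUnion fun i => {(f i).2.1, (f i).2.2} with hW
  have hYc : #Y ≤ k * N := by
    refine card_biUnion_le.trans ?_
    rw [sum_congr rfl fun i _ => (hP i).2.1]
    simp
  have hWc : #W ≤ k * 2 := by
    refine card_biUnion_le.trans ((sum_le_sum fun i _ => card_le_two).trans ?_)
    simp
  set A' : Finset V := {v ∈ A | d ≤ 2 * #(t v ∩ H)} \ Y with hA'
  have hA'c : #H * #H * N + N ≤ #A' := by
    have h1 : #{v ∈ A | d ≤ 2 * #(t v ∩ H)} - #Y ≤ #A' := le_card_sdiff Y _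
    have h2 : k * N + N ≤ h * N := by
      rw [← Nat.succ_mul]; exact Nat.mul_le_mul_right _ hk
    rw [add_mul] at hsize
    omega
  have hpair : ∀ v, ∃ z : V × V, v ∈ A' → z.1 ∈ t v ∧ z.2 ∈ t v ∧ z.1 ∈ H ∧ z.2 ∈ H ∧ z.1 ∉ W ∧
      z.2 ∉ W ∧ z.1 ≠ z.2 := by
    intro v
    by_cases hv : v ∈ A'
    · have h1 := (mem_filter.1 (mem_sdiff.1 hv).1).2
      have h2 := le_card_sdiff W (t v ∩ H)
      obtain ⟨w, hw, u, hu, hwu⟩ := one_lt_card.1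
        (show 1 < #((t v ∩ H) \ W) by omega)
      simp only [mem_sdiff, mem_inter] at hw hu
      exact ⟨(w, u), fun _ => ⟨hw.1.1, hu.1.1, hw.1.2, hu.1.2, hw.2, hu.2, hwu⟩⟩
    · exact ⟨(v, v), fun h => absurd h hv⟩
  choose g hg using hpair
  have hmaps : ∀ v ∈ A', g v ∈ H ×ˢ H := fun v hv =>
    mem_product.2 ⟨(hg v hv).2.2.1, (hg v hv).2.2.2.1⟩
  obtain ⟨v₀, hv₀⟩ := card_pos.1 (show 0 < #A' by omega)
  obtain ⟨z, -, hzc⟩ := exists_le_card_fiber_of_mul_le_card_of_maps_to hmaps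
    ⟨_, hmaps v₀ hv₀⟩ (n := N) (by rw [card_product]; omega)
  obtain ⟨Z, hZ, hZc⟩ := exists_subset_card_eq hzc
  have hZ' : ∀ v ∈ Z, v ∈ A' ∧ g v = z := fun v hv => mem_filter.1 (hZ hv)
  obtain ⟨v₁, hv₁⟩ := card_pos.1 (show 0 < #Z by omega)
  obtain ⟨hv₁A, rfl⟩ := hZ' v₁ hv₁
  obtain ⟨-, -, g3, g4, g5, g6, g7⟩ := hg v₁ hv₁A
  refine ⟨(Z, g v₁), ⟨fun v hv => ?_, hZc, hHB g3, g7, fun v hv => ?_⟩, fun i => ⟨?_, ?_⟩⟩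
  · exact (mem_filter.1 (mem_sdiff.1 (hZ' v hv).1).1).1
  · rw [← (hZ' v hv).2]
    exact ⟨(hg v (hZ' v hv).1).1, (hg v (hZ' v hv).1).2.1⟩
  · refine Finset.disjoint_right.2 fun v hv hv' => (mem_sdiff.1 (hZ' v hv).1).2 ?_
    exact mem_biUnion.2 ⟨i, mem_univ _, hv'⟩
  · refine Finset.disjoint_right.2 fun v hv hv' => ?_
    have hvW : v ∈ W := mem_biUnion.2 ⟨i, mem_univ _, hv'⟩
    rcases mem_insert.1 hv with rfl | hv
    · exact g5 hvW
    · rw [mem_singleton.1 hv] at hvW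
      exact g6 hvW

open Classical in
/-- The anticoncentration bound when many vertices have half of their neighbours in a set `L` of
vertices of small degree. -/
lemma card_fits_le_of_large (A B : Finset V) (a : ℤ → ℤ) (b : V → ℤ) (t : V → Finset V)
    (M d h D : ℕ) (hM : 1 ≤ M) (hh : 1 ≤ h) (hd : 16 * h ≤ d) (ht : ∀ v ∈ A, #(t v) = d)
    (htA : ∀ v ∉ A, #(t v) = 1) (L : Finset V) (hLB : L ⊆ B)
    (hLD : ∀ w ∈ L, #{v ∈ A | w ∈ t v} ≤ D) (hL : #A ≤ 2 * #{v ∈ A | d ≤ 2 * #(t v ∩ L)})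
    (hdA : 16 * h * Fintype.card V ≤ d * #A) (hV : 0 < Fintype.card V)
    (hsize : 4 * (2 * (h * (4 * d ^ (2 * h) * M ^ 4)) ^ 2 * (2 * h * d) * D) ≤ #A) :
    (#{σ ∈ Fintype.piFinset t | Fits A B a b σ} : ℝ) ≤
      (((1 : ℕ) / M ^ 2 : ℝ) ^ h + h * Real.exp (-(M ^ 4 : ℕ))) * #(Fintype.piFinset t) := by
  set K := 2 * (h * (4 * d ^ (2 * h) * M ^ 4)) ^ 2 with hK
  refine (exists_pairwise_of_forall_extend
    (fun z : Finset V × V × V × V => z.1 ⊆ A ∧ #z.1 = 2 * h ∧ z.2.1 ∈ z.1 ∧ z.2.2.1 ∈ L ∧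
      z.2.2.2 ∈ L ∧ z.2.2.2 ≠ z.2.2.1 ∧ z.2.2.2 ∈ t z.2.1 ∧ ∀ v ∈ z.1, z.2.2.1 ∈ t v)
    (fun z z' => ∀ v ∈ z.1, ∀ v' ∈ z'.1, Disjoint (t v ∩ L) (t v' ∩ L))
    (fun z z' hz v hv v' hv' => (hz v' hv' v hv).symm) K ?_).elim ?_
  swap
  · rintro f ⟨hP, hR⟩
    have hkey : Function.Injective fun i => (f i).2.1 := by
      intro i j hij
      by_contra hne
      have h1 := hR i j hne _ (hP i).2.2.1 _ (hP j).2.2.1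
      rw [show (f j).2.1 = (f i).2.1 from hij.symm, disjoint_self_iff_empty] at h1
      exact notMem_empty (f i).2.2.2 (h1 ▸ mem_inter.2 ⟨(hP i).2.2.2.2.2.2.1, (hP i).2.2.2.2.1⟩)
    set Γ : Finset V := univ.image fun i => (f i).2.1 with hΓ
    have hKpos : 0 < K := by
      have : 0 < d := by omega
      positivity
    have hidx : ∀ x, ∃ i, x ∈ Γ → (f i).2.1 = x := by
      intro x
      by_cases hx : x ∈ Γ
      · obtain ⟨i, -, hi⟩ := mem_image.1 hx
        exact ⟨i, fun _ => hi⟩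
      · exact ⟨⟨0, hKpos⟩, fun h => absurd h hx⟩
    choose idx hidx using hidx
    set U : Finset V := Γ.biUnion fun x => (f (idx x)).1 with hU
    have hUA : U ⊆ A := biUnion_subset.2 fun x _ => (hP _).1
    refine card_filter_piFinset_le_of_forall_subset (Fits A B a b)
      (fun v => if v ∈ U then d else 1) (fun v => by split_ifs <;> omega) _ t
      (fun v => ?_) fun t' ht' hc => ?_
    · split_ifs with hv
      · exact (ht v (hUA hv)).ge
      · by_cases hvA : v ∈ A
        · rw [ht v hvA]; omega
        · exact (htA v hvA).ge
    have htt : ∀ v ∈ U, t' v = t v := fun v hv =>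
      eq_of_subset_of_card_le (ht' v) (by rw [hc v, if_pos hv, ht v (hUA hv)])
    have hmemU : ∀ x ∈ Γ, ∀ v ∈ (f (idx x)).1, v ∈ U := fun x hx v hv =>
      mem_biUnion.2 ⟨x, hx, hv⟩
    have hself : ∀ x ∈ Γ, x ∈ (f (idx x)).1 := fun x hx => by
      have := (hP (idx x)).2.2.1
      rwa [hidx x hx] at this
    refine card_fits_le_of_blocks A B a b t' M (d ^ (2 * h)) h hM (Nat.pow_pos (by omega)) hh Γ
      (fun x => (f (idx x)).1) (fun x => (f (idx x)).2.2.1) (fun x => (f (idx x)).2.2.2)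
      (fun x _ => (hP _).1) hself (fun x _ => (hP _).2.1) ?_ ?_ ?_
      (fun x _ => (hP _).2.2.2.2.2.1) (fun x _ => hLB (hP _).2.2.2.1)
      (fun x _ => hLB (hP _).2.2.2.2.1) ?_ ?_ ?_ ?_
    · intro x hx v hv
      rw [htt v (hmemU x hx v hv)]
      exact (hP _).2.2.2.2.2.2.2 v hv
    · intro x hx v hv
      have hvU := hmemU x hx v hv
      rw [htt v hvU, ht v (hUA hvU)]
      omega
    · intro x hx
      rw [htt x (hmemU x hx x (hself x hx))]
      have := (hP (idx x)).2.2.2.2.2.2.1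
      rwa [hidx x hx] at this
    · intro x hx y hy hne v hv
      have hij : idx x ≠ idx y := fun h => hne (by rw [← hidx x hx, ← hidx y hy, h])
      have hdis := Finset.disjoint_left.1 (hR _ _ hij x (hself x hx) v hv)
      have hux := (hP (idx x)).2.2.2.2.2.2.1
      rw [hidx x hx] at hux
      rw [htt v (hmemU y hy v hv)]
      refine ⟨fun hm => hdis (mem_inter.2 ⟨(hP (idx x)).2.2.2.2.2.2.2 x (hself x hx),
        (hP _).2.2.2.1⟩) (mem_inter.2 ⟨hm, (hP _).2.2.2.1⟩), fun hm => hdis (mem_inter.2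
        ⟨hux, (hP _).2.2.2.2.1⟩) (mem_inter.2 ⟨hm, (hP _).2.2.2.2.1⟩)⟩
    · intro y hy
      rw [hc y, if_neg (mem_sdiff.1 hy).2]
    · intro x hx
      rw [prod_congr rfl fun v hv => by
        rw [htt v (hmemU x hx v hv), ht v (hUA (hmemU x hx v hv))], prod_const, (hP _).2.1]
    · rw [hΓ, card_image_of_injective _ hkey, card_univ, Fintype.card_fin]
  intro k hk f hP
  set C : Finset V := univ.biUnion fun i => (f i).1.biUnion fun v => t v ∩ L with hC
  have hCc : #C ≤ k * (2 * h * d) := by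
    refine card_biUnion_le.trans ((sum_le_sum (g := fun _ => 2 * h * d) fun i _ => ?_).trans ?_)
    · refine card_biUnion_le.trans ((sum_le_sum (g := fun _ => d) fun v hv => ?_).trans ?_)
      · exact (card_le_card inter_subset_left).trans (ht v ((hP i).1 hv)).le
      · rw [sum_const, (hP i).2.1, smul_eq_mul]
    · simp
  set bad : Finset V := {v ∈ A | ¬ Disjoint (t v) C} with hbad
  have hbadc : #bad ≤ #C * D := by
    have h1 : bad ⊆ C.biUnion fun w => {v ∈ A | w ∈ t v} := by
      intro v hv
      obtain ⟨hvA, hv⟩ := mem_filter.1 hv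
      obtain ⟨w, hw, hwC⟩ := Finset.not_disjoint_iff.1 hv
      exact mem_biUnion.2 ⟨w, hwC, mem_filter.2 ⟨hvA, hw⟩⟩
    refine (card_le_card h1).trans (card_biUnion_le_card_mul _ _ _ fun w hw => hLD w ?_)
    simp only [hC, mem_biUnion, mem_inter] at hw
    obtain ⟨i, -, v, -, -, hwL⟩ := hw
    exact hwL
  set A' : Finset V := {v ∈ A | d ≤ 2 * #(t v ∩ L)} \ bad with hA'
  have hA'c : #A ≤ 4 * #A' := by
    have h1 : #{v ∈ A | d ≤ 2 * #(t v ∩ L)} - #bad ≤ #A' := le_card_sdiff bad _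
    have h2 : #bad ≤ K * (2 * h * d) * D :=
      hbadc.trans (Nat.mul_le_mul_right _ (hCc.trans (Nat.mul_le_mul_right _ hk.le)))
    omega
  have hA'A : A' ⊆ A := sdiff_subset.trans (filter_subset _ _)
  obtain ⟨w, hwL, hw⟩ : ∃ w ∈ L, 2 * h ≤ #{v ∈ A' | w ∈ t v} := by
    by_contra! hcon
    have h1 : ∑ v ∈ A', #(t v ∩ L) = ∑ w ∈ L, #{v ∈ A' | w ∈ t v} := by
      have := sum_card_bipartiteAbove_eq_sum_card_bipartiteBelow (s := A') (t := L)
        (fun v w => w ∈ t v)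
      simp only [bipartiteAbove, bipartiteBelow] at this
      rw [← this]
      refine sum_congr rfl fun v _ => ?_
      congr 1
      ext w
      simp [and_comm]
    have h2 : ∑ w ∈ L, #{v ∈ A' | w ∈ t v} ≤ Fintype.card V * (2 * h - 1) := by
      refine (sum_le_sum fun w hw => Nat.le_sub_one_of_lt (hcon w hw)).trans ?_
      rw [sum_const, smul_eq_mul]
      exact Nat.mul_le_mul_right _ (card_le_univ _)
    have h3 : #A' * d ≤ ∑ v ∈ A', 2 * #(t v ∩ L) := by
      rw [← smul_eq_mul, ← sum_const]
      exact sum_le_sum fun v hv => (mem_filter.1 (mem_sdiff.1 hv).1).2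
    rw [← mul_sum, h1] at h3
    obtain ⟨l, hl⟩ : ∃ l, 2 * h = l + 1 := ⟨2 * h - 1, by omega⟩
    rw [hl, Nat.add_sub_cancel] at h2
    have h4 : d * #A ≤ d * (4 * #A') := Nat.mul_le_mul_left _ hA'c
    nlinarith
  obtain ⟨Z, hZ, hZc⟩ := exists_subset_card_eq hw
  have hZ' : ∀ v ∈ Z, v ∈ A' ∧ w ∈ t v := fun v hv => mem_filter.1 (hZ hv)
  obtain ⟨x, hx⟩ := card_pos.1 (show 0 < #Z by omega)
  have hxL : 1 < #(t x ∩ L) := by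
    have := (mem_filter.1 (mem_sdiff.1 (hZ' x hx).1).1).2
    omega
  obtain ⟨u, hu, huw⟩ := exists_mem_ne hxL w
  refine ⟨(Z, x, w, u), ⟨fun v hv => hA'A (hZ' v hv).1, hZc, hx, hwL, (mem_inter.1 hu).2, huw,
    (mem_inter.1 hu).1, fun v hv => (hZ' v hv).2⟩, fun i v hv v' hv' => ?_⟩
  have hv'A := (hZ' v' hv').1
  refine Finset.disjoint_left.2 fun y hy hy' => (mem_sdiff.1 hv'A).2 (mem_filter.2
    ⟨hA'A hv'A, Finset.not_disjoint_iff.2 ⟨y, (mem_inter.1 hy').1, ?_⟩⟩)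
  exact mem_biUnion.2 ⟨i, mem_univ _, mem_biUnion.2 ⟨v, hv, hy⟩⟩

open Classical in
/-- The anticoncentration bound with explicit parameters. -/
lemma card_fits_le (A B : Finset V) (a : ℤ → ℤ) (b : V → ℤ) (t : V → Finset V)
    (M d h : ℕ) (hM : 1 ≤ M) (hh : 1 ≤ h) (hd : 16 * h ≤ d) (htB : ∀ v ∈ A, t v ⊆ B)
    (ht : ∀ v ∈ A, d ≤ #(t v)) (htA : ∀ v ∉ A, #(t v) = 1)
    (hdA : 16 * h * Fintype.card V ≤ d * #A) (hV : 0 < Fintype.card V)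
    (hVM : Fintype.card V ≤ 2 ^ 64 * M ^ 64)
    (hsize : (256 * h ^ 3 * d ^ (4 * h + 1) + 8 * d * (h + (2 ^ 64 * d) ^ 2)) * M ^ 60 ≤ #A) :
    (#{σ ∈ Fintype.piFinset t | Fits A B a b σ} : ℝ) ≤
      (((2 * h : ℕ) / M ^ 2 : ℝ) ^ h + h * Real.exp (-(M ^ 4 : ℕ))) * #(Fintype.piFinset t) := by
  refine card_filter_piFinset_le_of_forall_subset (Fits A B a b)
    (fun v => if v ∈ A then d else 1) (fun v => by split_ifs <;> omega) _ t
    (fun v => ?_) fun t' ht' hc => ?_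
  · split_ifs with hv
    · exact ht v hv
    · exact (htA v hv).ge
  have hcA : ∀ v ∈ A, #(t' v) = d := fun v hv => by rw [hc v, if_pos hv]
  have hcA' : ∀ v ∉ A, #(t' v) = 1 := fun v hv => by rw [hc v, if_neg hv]
  set L : Finset V := {w ∈ B | #{v ∈ A | w ∈ t' v} ≤ M ^ 52} with hL
  set H : Finset V := {w ∈ B | ¬ #{v ∈ A | w ∈ t' v} ≤ M ^ 52} with hH
  have hLH : ∀ v ∈ A, #(t' v ∩ L) + #(t' v ∩ H) = d := by
    intro v hv
    rw [← card_union_of_disjoint, ← inter_union_distrib_left, filter_union_filter_not_eq,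
      inter_eq_left.2 ((ht' v).trans (htB v hv)), hcA v hv]
    exact (disjoint_filter_filter_not _ _ _).mono inter_subset_right inter_subset_right
  have hsplit : #A ≤ #{v ∈ A | d ≤ 2 * #(t' v ∩ L)} + #{v ∈ A | d ≤ 2 * #(t' v ∩ H)} := by
    refine (card_le_card fun v hv => ?_).trans (card_union_le _ _)
    simp only [mem_union, mem_filter]
    have := hLH v hv
    rcases le_total #(t' v ∩ L) #(t' v ∩ H) with h1 | h1
    · exact Or.inr ⟨hv, by omega⟩
    · exact Or.inl ⟨hv, by omega⟩
  have hAV : #A ≤ Fintype.card V := card_le_univ _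
  rw [add_mul] at hsize
  rcases le_total #{v ∈ A | d ≤ 2 * #(t' v ∩ H)} #{v ∈ A | d ≤ 2 * #(t' v ∩ L)} with h1 | h1
  · refine (card_fits_le_of_large A B a b t' M d h (M ^ 52) hM hh hd hcA hcA' L
      (filter_subset _ _) (fun w hw => (mem_filter.1 hw).2) (by omega) hdA hV ?_).trans ?_
    · refine le_trans (le_of_eq ?_) ((Nat.le_add_right _ _).trans hsize)
      ring
    · have h2 : ((1 : ℕ) : ℝ) ≤ ((2 * h : ℕ) : ℝ) := by exact_mod_cast (by omega : 1 ≤ 2 * h)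
      gcongr
  · refine card_fits_le_of_small A B a b t' M d h hM hh hd hcA H (filter_subset _ _)
      (by omega) (le_trans ?_ ((Nat.le_add_left _ _).trans hsize))
    have h2 : #H * M ^ 52 ≤ #A * d := by
      have h3 : ∑ w ∈ H, #{v ∈ A | w ∈ t' v} = ∑ v ∈ A, #(t' v ∩ H) := by
        have := sum_card_bipartiteAbove_eq_sum_card_bipartiteBelow (s := A) (t := H)
          (fun v w => w ∈ t' v)
        simp only [bipartiteAbove, bipartiteBelow] at this
        rw [← this]
        refine sum_congr rfl fun v _ => ?_
        congr 1
        ext w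
        simp [and_comm]
      calc #H * M ^ 52 ≤ ∑ w ∈ H, #{v ∈ A | w ∈ t' v} := by
            rw [← smul_eq_mul, ← sum_const]
            exact sum_le_sum fun w hw => (not_le.1 (mem_filter.1 hw).2).le
        _ ≤ ∑ _v ∈ A, d := by
            rw [h3]
            exact sum_le_sum fun v hv => by have := hLH v hv; omega
        _ = #A * d := by rw [sum_const, smul_eq_mul]
    have h3 : #H ≤ 2 ^ 64 * d * M ^ 12 := by
      refine Nat.le_of_mul_le_mul_right (c := M ^ 52) ?_ (Nat.pow_pos hM)
      calc #H * M ^ 52 ≤ #A * d := h2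
        _ ≤ (2 ^ 64 * M ^ 64) * d := Nat.mul_le_mul_right _ (hAV.trans hVM)
        _ = _ := by ring
    have h4 : h + #H * #H ≤ (h + (2 ^ 64 * d) ^ 2) * M ^ 24 := by
      have h5 : h * 1 ≤ h * M ^ 24 := Nat.mul_le_mul_left _ (Nat.one_le_pow _ _ hM)
      have h6 := Nat.mul_le_mul h3 h3
      calc h + #H * #H ≤ h * M ^ 24 + 2 ^ 64 * d * M ^ 12 * (2 ^ 64 * d * M ^ 12) := by omega
        _ = _ := by ring
    calc 2 * ((h + #H * #H) * (4 * d * M ^ 4))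
        ≤ 2 * ((h + (2 ^ 64 * d) ^ 2) * M ^ 24 * (4 * d * M ^ 4)) := by gcongr
      _ = 8 * d * (h + (2 ^ 64 * d) ^ 2) * M ^ 28 := by ring
      _ ≤ 8 * d * (h + (2 ^ 64 * d) ^ 2) * M ^ 60 := by
        gcongr
        · norm_num

lemma pow_add_exp_le (M h : ℕ) (hh : 1 ≤ h) (hM : 2 * h ≤ M) (hfac : h * h.factorial ≤ M) :
    ((2 * h : ℕ) / M ^ 2 : ℝ) ^ h + h * Real.exp (-(M ^ 4 : ℕ)) ≤ ((M : ℝ) ^ (h - 1))⁻¹ := by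
  have hM2 : (2 : ℝ) ≤ M := by exact_mod_cast (by omega : 2 ≤ M)
  have hM0 : (0 : ℝ) < M := by linarith
  have h1 : ((2 * h : ℕ) / M ^ 2 : ℝ) ^ h ≤ ((M : ℝ) ^ h)⁻¹ := by
    rw [← inv_pow]
    refine pow_le_pow_left₀ (by positivity) ?_ _
    rw [div_le_iff₀ (by positivity), pow_two, inv_mul_cancel_left₀ hM0.ne']
    exact_mod_cast hM
  have h2 : (h : ℝ) * Real.exp (-(M ^ 4 : ℕ)) ≤ ((M : ℝ) ^ h)⁻¹ := by
    have h3 := Real.pow_div_factorial_le_exp ((M ^ 4 : ℕ) : ℝ) (by positivity) h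
    rw [Real.exp_neg, ← div_eq_mul_inv, div_le_iff₀ (Real.exp_pos _), inv_mul_eq_div,
      le_div_iff₀ (by positivity)]
    refine le_trans ?_ h3
    rw [le_div_iff₀ (by positivity)]
    calc (h : ℝ) * M ^ h * h.factorial = (h * h.factorial : ℕ) * M ^ h := by push_cast; ring
      _ ≤ M * M ^ h := by gcongr
      _ = M ^ (h + 1) := by ring
      _ ≤ M ^ (4 * h) := pow_le_pow_right₀ (by linarith) (by omega)
      _ = ((M ^ 4 : ℕ) : ℝ) ^ h := by push_cast; rw [pow_mul]
  have h3 : ((M : ℝ) ^ h)⁻¹ + ((M : ℝ) ^ h)⁻¹ ≤ ((M : ℝ) ^ (h - 1))⁻¹ := by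
    obtain ⟨l, rfl⟩ : ∃ l, h = l + 1 := ⟨h - 1, by omega⟩
    rw [Nat.add_sub_cancel, ← two_mul, pow_succ, mul_inv, mul_left_comm]
    refine mul_le_of_le_one_right (by positivity) ?_
    rw [← div_eq_mul_inv, div_le_one hM0]
    exact hM2
  linarith

lemma exists_pow_le_lt_succ_pow (k : ℕ) (hk : k ≠ 0) (m n : ℕ) (h : m ^ k ≤ n) :
    ∃ M, m ≤ M ∧ M ^ k ≤ n ∧ n < (M + 1) ^ k := by
  have hle : ∀ i, i ≤ i ^ k := fun i => Nat.le_self_pow hk i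
  refine ⟨Nat.findGreatest (fun i => i ^ k ≤ n) n,
    Nat.le_findGreatest (P := fun i => i ^ k ≤ n) ((hle m).trans h) h,
    Nat.findGreatest_spec (P := fun i => i ^ k ≤ n) ((hle m).trans h) h, ?_⟩
  by_contra! hcon
  have := Nat.le_findGreatest (P := fun i => i ^ k ≤ n) ((hle _).trans hcon) hcon
  omega

open Classical in
/-- The probability that the shifted loads have given level counts. -/
lemma exists_card_fits_le (c : ℝ) (hc : 0 < c) (d : ℕ) (hd : 66 / c ≤ d) (hc1 : c ≤ 1) :
    ∃ n₀ : ℕ, ∀ (V : Type) [Fintype V] [DecidableEq V] (A B : Finset V) (a : ℤ → ℤ) (b : V → ℤ)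
      (t : V → Finset V), n₀ ≤ Fintype.card V → (∀ v ∈ A, t v ⊆ B) → (∀ v ∈ A, d ≤ #(t v)) →
      (∀ v ∉ A, #(t v) = 1) → (#A : ℝ) = c * Fintype.card V →
      (#{σ ∈ Fintype.piFinset t | Fits A B a b σ} : ℝ) ≤
        (Fintype.card V : ℝ) ^ (-(1 / 4096 * c * d)) * #(Fintype.piFinset t) := by
  rw [div_le_iff₀ hc] at hd
  set h := ⌊(d : ℝ) * c / 16⌋₊ with hh
  have hh1 : (h : ℝ) ≤ d * c / 16 := Nat.floor_le (by positivity)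
  have hh2 : (d : ℝ) * c / 16 < h + 1 := Nat.lt_floor_add_one _
  have hh3 : 1 ≤ h := Nat.le_floor (by push_cast; linarith)
  have hhd : 16 * h ≤ d := by
    have : (16 * h : ℝ) ≤ d := by nlinarith [Nat.cast_nonneg (α := ℝ) d]
    exact_mod_cast this
  set E : ℕ := 256 * h ^ 3 * d ^ (4 * h + 1) + 8 * d * (h + (2 ^ 64 * d) ^ 2) with hE
  set M₀ : ℕ := 2 * h + h * h.factorial + ⌈(E : ℝ) / c⌉₊ with hM₀
  clear_value h E
  refine ⟨M₀ ^ 64, fun V _ _ A B a b t hn htB ht htA hA => ?_⟩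
  set n := Fintype.card V with hn'
  obtain ⟨M, hM3, hM1, hM2⟩ := exists_pow_le_lt_succ_pow 64 (by norm_num) M₀ n hn
  have hMh : 2 * h ≤ M := by omega
  have hMf : h * h.factorial ≤ M := by omega
  have hMc : (E : ℝ) ≤ c * M := by
    have h1 : (E : ℝ) / c ≤ M := (Nat.le_ceil _).trans (by exact_mod_cast (by omega))
    rwa [div_le_iff₀ hc, mul_comm] at h1
  have hM4 : n ≤ 2 ^ 64 * M ^ 64 := by
    rw [← mul_pow]
    exact hM2.le.trans (Nat.pow_le_pow_left (by omega) _)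
  have hM5 : n ≤ M ^ 128 := by
    rw [show 128 = 2 * 64 from rfl, pow_mul, pow_two]
    refine hM2.le.trans (Nat.pow_le_pow_left ?_ _)
    have := Nat.mul_le_mul_right M (show 2 ≤ M by omega)
    omega
  clear hM2
  have hMr : (1 : ℝ) ≤ M := by exact_mod_cast (by omega : 1 ≤ M)
  have hn1 : 1 ≤ n := (Nat.one_le_pow 64 M (by omega)).trans hM1
  have key := card_fits_le A B a b t M d h (by omega) hh3 hhd htB ht htA ?_ hn1 ?_ ?_
  · refine key.trans (mul_le_mul_of_nonneg_right ((pow_add_exp_le M h hh3 hMh hMf).trans ?_)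
      (Nat.cast_nonneg _))
    have hnM : (n : ℝ) ≤ (M : ℝ) ^ (128 : ℝ) := by
      rw [show (128 : ℝ) = ((128 : ℕ) : ℝ) by norm_num, Real.rpow_natCast]
      exact_mod_cast hM5
    rw [← Real.rpow_natCast, ← Real.rpow_neg (by linarith)]
    refine le_trans ?_ (Real.rpow_le_rpow_of_nonpos (by exact_mod_cast hn1) hnM
      (neg_nonpos.2 (by positivity)))
    rw [← Real.rpow_mul (by linarith)]
    refine Real.rpow_le_rpow_of_exponent_le hMr ?_
    rw [Nat.cast_sub hh3]
    push_cast
    linarith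
  · have : (16 * h * n : ℝ) ≤ d * #A := by
      rw [hA]
      have := mul_le_mul_of_nonneg_right hh1 (Nat.cast_nonneg (α := ℝ) n)
      linarith
    exact_mod_cast this
  · exact hM4
  · have h1 : (E : ℝ) * M ^ 60 ≤ #A := by
      rw [hA]
      calc (E : ℝ) * M ^ 60 ≤ c * M * M ^ 60 := by gcongr
        _ = c * M ^ 61 := by ring
        _ ≤ c * M ^ 64 := by gcongr; norm_num
        _ ≤ c * n := by gcongr; exact_mod_cast hM1
    rw [← hE]
    exact_mod_cast h1

open Classical in
/-- Recording the degree sequence of the random subgraph amounts to recording the loads. -/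
lemma fits_of_ncard_eq (A B : Finset V) (hAB : ∀ v, v ∈ A ∨ v ∈ B) (hdis : Disjoint A B)
    (a : ℤ → ℤ) (b : V → ℤ) (σ : V → V) (hσ : ∀ v ∈ A, σ v ∈ B)
    (h : ∀ k : ℤ, ({v : V | (((SimpleGraph.fromRel
      (fun x y => x ∈ A ∧ y = σ x)).neighborSet v).ncard : ℤ) + b v = k}.ncard : ℤ) = a k) :
    Fits A B (fun k => a k - #{v ∈ A | 1 + b v = k}) b σ := by
  have hA : ∀ v ∈ A, ((SimpleGraph.fromRel
      (fun x y => x ∈ A ∧ y = σ x)).neighborSet v).ncard = 1 := by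
    intro v hv
    rw [Set.ncard_eq_one]
    refine ⟨σ v, ?_⟩
    ext y
    simp only [SimpleGraph.mem_neighborSet, SimpleGraph.fromRel_adj, Set.mem_singleton_iff]
    constructor
    · rintro ⟨-, ⟨-, rfl⟩ | ⟨hy, rfl⟩⟩
      · rfl
      · exact absurd (hσ y hy) (Finset.disjoint_left.1 hdis hv)
    · rintro rfl
      exact ⟨fun he => Finset.disjoint_left.1 hdis hv (he ▸ hσ v hv), Or.inl ⟨hv, rfl⟩⟩
  have hB : ∀ v ∈ B, (((SimpleGraph.fromRel
      (fun x y => x ∈ A ∧ y = σ x)).neighborSet v).ncard : ℤ) = load A σ v := by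
    intro v hv
    rw [load, ← Set.ncard_coe_finset]
    congr 2
    ext y
    simp only [SimpleGraph.mem_neighborSet, SimpleGraph.fromRel_adj, coe_filter,
      Set.mem_ofPred_eq]
    constructor
    · rintro ⟨-, ⟨hvA, -⟩ | ⟨hy, rfl⟩⟩
      · exact absurd hv (Finset.disjoint_left.1 hdis hvA)
      · exact ⟨hy, rfl⟩
    · rintro ⟨hy, rfl⟩
      exact ⟨fun he => Finset.disjoint_left.1 hdis hy (he ▸ hv), Or.inr ⟨hy, rfl⟩⟩
  intro k
  dsimp only
  rw [← h k, eq_sub_iff_add_eq, ← Nat.cast_add, ← card_union_of_disjoint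
    (disjoint_filter_filter hdis.symm), ← Set.ncard_coe_finset]
  congr 2
  ext v
  simp only [coe_union, coe_filter, Set.mem_union, Set.mem_ofPred_eq]
  constructor
  · rintro (⟨hv, hk⟩ | ⟨hv, hk⟩)
    · rw [hB v hv]; exact hk
    · rw [hA v hv]; exact_mod_cast hk
  · intro hk
    rcases hAB v with hv | hv
    · rw [hA v hv] at hk; exact Or.inr ⟨hv, by exact_mod_cast hk⟩
    · rw [hB v hv] at hk; exact Or.inl ⟨hv, hk⟩

end DegreeSequence

/- The random subgraph `H` of the bipartite graph `G` (with parts `A` and `B`) is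
obtained by independently keeping, for each `v ∈ A`, one uniformly random edge incident
to `v`. It is encoded by a function `σ : V → V` with `σ v ∈ N_G(v)` for `v ∈ A` (the
kept edge at `v` is `{v, σ v}`) and `σ v = v` for `v ∉ A` (so that a uniformly random
valid `σ` corresponds to the uniform independent choices); then
`H = SimpleGraph.fromRel (fun x y => x ∈ A ∧ y = σ x)`, and probabilities are ratios of
counts of valid functions `σ`. -/

/-- There is a constant `c₀ > 0` such that the following holds. Let `0 < c ≤ 1`, let
`d ≥ 66/c`, and let `n` be sufficiently large relative to `d` (and `c`). Suppose `G` is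
a bipartite graph with `n` vertices and bipartition `V(G) = A ∪ B`, where every vertex
in `A` has degree at least `d` and `|A| = c·n`. Given integers `a_k` (`k ∈ ℤ`) and `b_v`
(`v ∈ V(G)`), let `H` be the random subgraph of `G` obtained by independently keeping
one uniformly random edge at each `v ∈ A`, and let `n_H(k)` be the number of vertices
`v` with `d_H(v) + b_v = k`. Then `ℙ(n_H(k) = a_k for every k) ≤ n^{-c₀·c·d}`. -/
theorem bipartite_degree_sequence_anticoncentration :
    ∃ c₀ : ℝ, 0 < c₀ ∧
      ∀ c : ℝ, 0 < c → c ≤ 1 → ∀ d : ℕ, 66 / c ≤ (d : ℝ) → ∃ n₀ : ℕ,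
        ∀ (V : Type) [Fintype V] [DecidableEq V] (G : SimpleGraph V) [DecidableRel G.Adj]
          (A B : Set V), n₀ ≤ Fintype.card V →
          A ∪ B = Set.univ → Disjoint A B →
          (∀ x y : V, G.Adj x y → (x ∈ A ∧ y ∈ B) ∨ (x ∈ B ∧ y ∈ A)) →
          (∀ v ∈ A, d ≤ G.degree v) →
          (A.ncard : ℝ) = c * (Fintype.card V : ℝ) →
          ∀ (a : ℤ → ℤ) (b : V → ℤ),
            ({σ : V → V | ((∀ v ∈ A, σ v ∈ G.neighborSet v) ∧ ∀ v ∉ A, σ v = v) ∧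
                  ∀ k : ℤ,
                    (({v : V | (((SimpleGraph.fromRel
                          (fun x y => x ∈ A ∧ y = σ x)).neighborSet v).ncard : ℤ) +
                        b v = k}.ncard : ℤ) = a k)}.ncard : ℝ) /
                ({σ : V → V | (∀ v ∈ A, σ v ∈ G.neighborSet v) ∧
                    ∀ v ∉ A, σ v = v}.ncard : ℝ) ≤
              (Fintype.card V : ℝ) ^ (-(c₀ * c * (d : ℝ))) := by
  refine ⟨1 / 4096, by norm_num, fun c hc hc1 d hd => ?_⟩
  obtain ⟨n₀, hn₀⟩ := DegreeSequence.exists_card_fits_le c hc d hd hc1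
  refine ⟨n₀, fun V _ _ G _ A B hn hAB hdis hG hdeg hcard a b => ?_⟩
  classical
  set t : V → Finset V := fun v => if v ∈ A then G.neighborFinset v else {v} with ht
  have hAmem : ∀ v, v ∈ A.toFinset ↔ v ∈ A := fun v => Set.mem_toFinset
  have hBmem : ∀ v, v ∈ B.toFinset ↔ v ∈ B := fun v => Set.mem_toFinset
  have hadj : ∀ v ∈ A, ∀ w, G.Adj v w → w ∈ B := by
    intro v hv w hvw
    rcases hG v w hvw with h | h
    · exact h.2
    · exact absurd h.1 (Set.disjoint_left.1 hdis hv)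
  have hset : {σ : V → V | (∀ v ∈ A, σ v ∈ G.neighborSet v) ∧ ∀ v ∉ A, σ v = v} =
      (Fintype.piFinset t : Set (V → V)) := by
    ext σ
    simp only [Set.mem_ofPred_eq, Finset.mem_coe, Fintype.mem_piFinset, ht]
    constructor
    · rintro ⟨h1, h2⟩ v
      split_ifs with hv
      · simpa using h1 v hv
      · simpa using h2 v hv
    · intro h
      refine ⟨fun v hv => ?_, fun v hv => ?_⟩
      · simpa [hv] using h v
      · simpa [hv] using h v
  set a' : ℤ → ℤ := fun k => a k - (A.toFinset.filter fun v => 1 + b v = k).card with ha'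
  have hsub : {σ : V → V | ((∀ v ∈ A, σ v ∈ G.neighborSet v) ∧ ∀ v ∉ A, σ v = v) ∧
        ∀ k : ℤ, (({v : V | (((SimpleGraph.fromRel
          (fun x y => x ∈ A ∧ y = σ x)).neighborSet v).ncard : ℤ) + b v = k}.ncard : ℤ) = a k)} ⊆
      ((Fintype.piFinset t).filter (DegreeSequence.Fits A.toFinset B.toFinset a' b) :
        Finset (V → V)) := by
    rintro σ ⟨h1, h2⟩
    rw [Finset.mem_coe, Finset.mem_filter, ← Finset.mem_coe, ← hset]
    refine ⟨h1, DegreeSequence.fits_of_ncard_eq _ _ (fun v => ?_) ?_ a b σ (fun v hv => ?_) ?_⟩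
    · rw [hAmem, hBmem, ← Set.mem_union, hAB]
      exact Set.mem_univ v
    · exact Set.disjoint_toFinset.2 hdis
    · rw [hBmem]
      rw [hAmem] at hv
      exact hadj v hv _ (h1.1 v hv)
    · simpa only [hAmem] using h2
  have hmain := hn₀ V A.toFinset B.toFinset a' b t hn
    (fun v hv w hw => by
      rw [hAmem] at hv
      simp only [ht, if_pos hv, SimpleGraph.mem_neighborFinset] at hw
      exact (hBmem w).2 (hadj v hv w hw))
    (fun v hv => by
      rw [hAmem] at hv
      simpa [ht, hv] using hdeg v hv)
    (fun v hv => by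
      rw [hAmem] at hv
      simp [ht, hv])
    (by rw [← hcard, Set.ncard_eq_toFinset_card'])
  rw [hset, Set.ncard_coe_finset]
  refine div_le_of_le_mul₀ (Nat.cast_nonneg _) (by positivity) (le_trans ?_ hmain)
  rw [← Set.ncard_coe_finset]
  exact_mod_cast Set.ncard_le_ncard hsub (Finset.finite_toSet _)
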